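/- arXiv:2201.12840 — 2 statements merged into one kernel-verified Lean document; each statement's English description precedes it below -/
import Mathlib

section
/- Let τ > (d+1)/d and define G_τ = {x ∈ 𝕋^d : there exist infinitely many odd integers q and even integers p₁,…,p_d with |q x_j − p_j| ≤ q^{1−τ} for all 1 ≤ j ≤ d}. Then the Hausdorff dimension of G_τ equals (d+1)/τ. -/
open Real MeasureTheory

/-- A set of zero Hausdorff measure can be covered by countably many open balls for which
all finite sums of `s`-th powers of the radii are arbitrarily small. -/
theorem exists_ball_cover_of_hausdorffMeasure_eq_zero {X : Type*} [MetricSpace X] [Nonempty X]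
    [MeasurableSpace X] [BorelSpace X] {s : ℝ} (hs : 0 < s) {K : Set X}
    (hK : μH[s] K = 0) {κ : ℝ} (hκ : 0 < κ) :
    ∃ (u : ℕ → X) (ρ : ℕ → ℝ), (∀ n, 0 < ρ n) ∧ K ⊆ ⋃ n, Metric.ball (u n) (ρ n) ∧
      ∀ I : Finset ℕ, ∑ n ∈ I, ρ n ^ s ≤ κ := by
  classical
  have hκ2 : 0 < ENNReal.ofReal (κ / 2) := by simpa using hκ
  rw [Measure.hausdorffMeasure_apply] at hK
  have h1 : (⨅ (t : ℕ → Set X) (_ : K ⊆ ⋃ n, t n) (_ : ∀ n, Metric.ediam (t n) ≤ 1),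
      ∑' n, ⨆ _ : (t n).Nonempty, Metric.ediam (t n) ^ s) < ENNReal.ofReal (κ / 2) := by
    refine lt_of_le_of_lt ?_ hκ2
    rw [← hK]
    exact le_iSup₂_of_le (1 : ENNReal) one_pos le_rfl
  simp only [iInf_lt_iff] at h1
  obtain ⟨t, hKt, -, hsum⟩ := h1
  obtain ⟨e, he, hesum⟩ := ENNReal.exists_pos_sum_of_countable' hκ2.ne' ℕ
  set a : ℕ → ENNReal := fun n => ⨆ _ : (t n).Nonempty, Metric.ediam (t n) ^ s with ha
  have htot : ∑' n, (a n + e n) ≤ ENNReal.ofReal κ := by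
    rw [ENNReal.tsum_add]
    calc _ ≤ ENNReal.ofReal (κ / 2) + ENNReal.ofReal (κ / 2) := add_le_add hsum.le hesum.le
      _ = ENNReal.ofReal κ := by
        rw [← ENNReal.ofReal_add (by positivity) (by positivity)]; congr 1; ring
  have hfin : ∀ n, a n + e n ≠ ⊤ := fun n =>
    ((ENNReal.le_tsum n).trans htot).trans_lt ENNReal.ofReal_lt_top |>.ne
  have hpos : ∀ n, 0 < (a n + e n).toReal := fun n =>
    ENNReal.toReal_pos (by have := he n; positivity) (hfin n)
  have hpow : ∀ n, ((a n + e n).toReal ^ s⁻¹) ^ s = (a n + e n).toReal := fun n =>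
    Real.rpow_inv_rpow (hpos n).le hs.ne'
  refine ⟨fun n => if h : (t n).Nonempty then h.some else Classical.arbitrary X,
    fun n => (a n + e n).toReal ^ s⁻¹, fun n => Real.rpow_pos_of_pos (hpos n) _, ?_, ?_⟩
  · refine hKt.trans (Set.iUnion_mono fun n x hx => ?_)
    have hne : (t n).Nonempty := ⟨x, hx⟩
    have hlt : edist x hne.some ^ s < a n + e n := by
      calc edist x hne.some ^ s ≤ Metric.ediam (t n) ^ s :=
            ENNReal.rpow_le_rpow (Metric.edist_le_ediam_of_mem hx hne.some_mem) hs.le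
        _ ≤ a n := by simp [ha, hne]
        _ < a n + e n := ENNReal.lt_add_right
            (ne_top_of_le_ne_top (hfin n) le_self_add) (he n).ne'
    simp only [hne, dif_pos, Metric.mem_ball]
    rw [← Real.rpow_lt_rpow_iff dist_nonneg (Real.rpow_nonneg (hpos n).le _) hs, hpow,
      dist_edist, ENNReal.toReal_rpow]
    exact (ENNReal.toReal_lt_toReal (hlt.ne_top) (hfin n)).2 hlt
  · intro I
    simp only [hpow]
    rw [← ENNReal.toReal_sum fun n _ => hfin n]
    exact ENNReal.toReal_le_of_le_ofReal hκ.le ((ENNReal.sum_le_tsum I).trans htot)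

/-- A discrete mass distribution principle for nested families of balls. -/
theorem hausdorffMeasure_iInter_ne_zero {X : Type*} [MetricSpace X] [ProperSpace X]
    [MeasurableSpace X] [BorelSpace X] {s A : ℝ} (hs : 0 < s) (hA : 0 < A)
    (F : ℕ → Finset X) (δ : ℕ → ℝ) (hF : ∀ n, (F n).Nonempty) (hδ : ∀ n, 0 < δ n)
    (hδ0 : Filter.Tendsto δ Filter.atTop (nhds 0))
    (hnest : ∀ n, (⋃ x ∈ F (n + 1), Metric.closedBall x (δ (n + 1))) ⊆
      ⋃ x ∈ F n, Metric.closedBall x (δ n))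
    (hcount : ∀ n u ρ, δ n ≤ ρ → ρ ≤ δ 0 → ∀ S ⊆ F n,
      (∀ y ∈ S, (Metric.closedBall y (δ n) ∩ Metric.closedBall u ρ).Nonempty) →
      (S.card : ℝ) ≤ A * ρ ^ s * (F n).card) :
    μH[s] (⋂ n, ⋃ x ∈ F n, Metric.closedBall x (δ n)) ≠ 0 := by
  classical
  intro h0
  have : Nonempty X := ⟨(hF 0).choose⟩
  set V : ℕ → Set X := fun n => ⋃ x ∈ F n, Metric.closedBall x (δ n) with hV
  set κ : ℝ := min (δ 0 ^ s) (1 / (2 * A)) with hκ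
  have hκpos : 0 < κ := lt_min (Real.rpow_pos_of_pos (hδ 0) _) (by positivity)
  obtain ⟨u, ρ, hρ, hcov, hsum⟩ := exists_ball_cover_of_hausdorffMeasure_eq_zero hs h0 hκpos
  have hanti : Antitone V := antitone_nat_of_succ_le hnest
  have hVc : ∀ n, IsCompact (V n) := fun n =>
    (F n).isCompact_biUnion fun x _ => isCompact_closedBall x (δ n)
  obtain ⟨m, hm⟩ := exists_subset_nhds_of_isCompact (V := V) hanti.directed_ge hVc
    (U := ⋃ n, Metric.ball (u n) (ρ n))
    (fun x hx => (isOpen_iUnion fun n => Metric.isOpen_ball).mem_nhds (hcov hx))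
  obtain ⟨I, hI⟩ := (hVc m).elim_finite_subcover _ (fun n => Metric.isOpen_ball) hm
  have hev : ∀ᶠ k in Filter.atTop, m ≤ k ∧ ∀ i ∈ I, δ k ≤ ρ i := by
    refine (Filter.eventually_ge_atTop m).and ?_
    rw [Filter.eventually_all_finset]
    exact fun i _ => hδ0.eventually_le_const (hρ i)
  obtain ⟨k, hmk, hk⟩ := hev.exists
  have hsub : F k ⊆ I.biUnion fun i => {y ∈ F k |
      (Metric.closedBall y (δ k) ∩ Metric.closedBall (u i) (ρ i)).Nonempty} := by
    intro y hy
    have hyV : y ∈ V k := by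
      simp only [hV, Set.mem_iUnion]
      exact ⟨y, hy, Metric.mem_closedBall_self (hδ k).le⟩
    have := hI (hanti hmk hyV)
    simp only [Set.mem_iUnion] at this
    obtain ⟨i, hi, hyi⟩ := this
    simp only [Finset.mem_biUnion, Finset.mem_filter]
    exact ⟨i, hi, hy, y, Metric.mem_closedBall_self (hδ k).le, Metric.ball_subset_closedBall hyi⟩
  have hle : ((F k).card : ℝ) ≤ ∑ i ∈ I, A * ρ i ^ s * (F k).card := by
    calc ((F k).card : ℝ) ≤ ∑ i ∈ I, (({y ∈ F k |
      (Metric.closedBall y (δ k) ∩ Metric.closedBall (u i) (ρ i)).Nonempty}).card : ℝ) := by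
          exact_mod_cast (Finset.card_le_card hsub).trans Finset.card_biUnion_le
      _ ≤ _ := by
        refine Finset.sum_le_sum fun i hi => ?_
        refine hcount k (u i) (ρ i) (hk i hi) ?_ _ (Finset.filter_subset _ _)
          fun y hy => (Finset.mem_filter.1 hy).2
        rw [← Real.rpow_le_rpow_iff (hρ i).le (hδ 0).le hs]
        have := hsum {i}
        rw [Finset.sum_singleton] at this
        exact this.trans (min_le_left _ _)
  rw [← Finset.sum_mul, ← Finset.mul_sum] at hle
  have hc : (0 : ℝ) < (F k).card := by exact_mod_cast (hF k).card_pos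
  have h1 : 1 ≤ A * ∑ i ∈ I, ρ i ^ s := by
    by_contra h
    push Not at h
    nlinarith
  have h2 : A * ∑ i ∈ I, ρ i ^ s ≤ A * (1 / (2 * A)) :=
    mul_le_mul_of_nonneg_left ((hsum I).trans (min_le_right _ _)) hA.le
  have h3 : A * (1 / (2 * A)) = 1 / 2 := by field_simp
  linarith

/-- Infinitely many dyadic intervals contain many primes. -/
theorem frequently_rpow_le_card_primes {ε : ℝ} (hε : 0 < ε) :
    ∃ᶠ M : ℕ in Filter.atTop,
      (M : ℝ) ^ (1 - ε) ≤ (({p ∈ Finset.Ico M (2 * M) | p.Prime}).card : ℝ) := by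
  intro hcon
  obtain ⟨M₀, hM₀⟩ := Filter.eventually_atTop.1 hcon
  set f : ℕ → ℝ := Set.indicator {p : ℕ | p.Prime} (fun n : ℕ => (1 : ℝ) / n) with hf
  have hf0 : ∀ n, 0 ≤ f n := fun n => Set.indicator_nonneg (fun _ _ => by positivity) _
  have hblock : ∀ k : ℕ, M₀ ≤ 2 ^ k →
      ∑ n ∈ Finset.Ico (2 ^ k) (2 ^ (k + 1)), f n ≤ ((2 : ℝ) ^ (-ε)) ^ k := by
    intro k hk
    have h1 := hM₀ _ hk
    push Not at h1
    have h2 : ∑ n ∈ Finset.Ico (2 ^ k) (2 ^ (k + 1)), f n ≤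
        (({p ∈ Finset.Ico (2 ^ k) (2 * 2 ^ k) | p.Prime}).card : ℝ) * (1 / 2 ^ k) := by
      rw [← nsmul_eq_mul, pow_succ', hf]
      rw [Finset.sum_indicator_eq_sum_filter]
      refine Finset.sum_le_card_nsmul _ _ _ fun n hn => ?_
      simp only [Finset.mem_filter, Finset.mem_Ico] at hn
      have : (2 : ℝ) ^ k ≤ n := by exact_mod_cast hn.1.1
      exact one_div_le_one_div_of_le (by positivity) this
    refine h2.trans ?_
    have h3 : (((2 ^ k : ℕ) : ℝ) ^ (1 - ε)) * (1 / 2 ^ k) = ((2 : ℝ) ^ (-ε)) ^ k := by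
      push_cast
      rw [sub_eq_add_neg, Real.rpow_add (by positivity), Real.rpow_one,
        ← Real.rpow_natCast 2 k, ← Real.rpow_mul (by norm_num), ← Real.rpow_natCast _ k,
        ← Real.rpow_mul (by norm_num), mul_comm (k : ℝ) (-ε)]
      field_simp
    rw [← h3]
    exact mul_le_mul_of_nonneg_right h1.le (by positivity)
  have hr0 : (0 : ℝ) ≤ 2 ^ (-ε) := by positivity
  have hr1 : (2 : ℝ) ^ (-ε) < 1 := Real.rpow_lt_one_of_one_lt_of_neg (by norm_num) (by linarith)
  have hk₀ : M₀ ≤ 2 ^ M₀ := Nat.lt_two_pow_self.le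
  have hpart : ∀ j : ℕ, ∑ n ∈ Finset.range (2 ^ (M₀ + j)), f n ≤
      ∑ n ∈ Finset.range (2 ^ M₀), f n + ∑ k ∈ Finset.range (M₀ + j), ((2 : ℝ) ^ (-ε)) ^ k := by
    intro j
    induction j with
    | zero => simpa using Finset.sum_nonneg fun k _ => pow_nonneg hr0 k
    | succ j ih =>
      rw [← add_assoc, Finset.sum_range_succ (fun k => ((2 : ℝ) ^ (-ε)) ^ k),
        ← Finset.sum_range_add_sum_Ico f (Nat.pow_le_pow_right (n := 2) (by norm_num)
          (Nat.le_succ (M₀ + j)))]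
      have := hblock (M₀ + j) (hk₀.trans (Nat.pow_le_pow_right (by norm_num) (by omega)))
      simp only [Nat.succ_eq_add_one]
      linarith
  refine not_summable_one_div_on_primes (summable_of_sum_range_le (c :=
    ∑ n ∈ Finset.range (2 ^ M₀), f n + (1 - (2 : ℝ) ^ (-ε))⁻¹) hf0 fun n => ?_)
  refine le_trans (Finset.sum_le_sum_of_subset_of_nonneg (t := Finset.range (2 ^ (M₀ + n))) ?_
    fun i _ _ => hf0 i) ((hpart n).trans ?_)
  · intro i hi
    rw [Finset.mem_range] at hi ⊢
    exact hi.trans (Nat.lt_two_pow_self.trans_le (Nat.pow_le_pow_right (by norm_num) (by omega)))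
  · gcongr
    rw [← tsum_geometric_of_lt_one hr0 hr1]
    exact (summable_geometric_of_lt_one hr0 hr1).sum_le_tsum _ fun i _ => pow_nonneg hr0 i

theorem tsum_weight_ne_top (d : ℕ) {τ s : ℝ} (h : (d : ℝ) + 1 < τ * s) :
    ∑' q : ℕ, ENNReal.ofReal (((q : ℝ) + 3) ^ d * (2 * (q : ℝ) ^ (-τ)) ^ s) ≠ ⊤ := by
  have hsum : Summable fun q : ℕ => ((q : ℝ) + 3) ^ d * (2 * (q : ℝ) ^ (-τ)) ^ s := by
    have h2 : Summable fun q : ℕ => (4 ^ d * 2 ^ s) * (q : ℝ) ^ ((d : ℝ) - τ * s) :=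
      (Real.summable_nat_rpow.2 (by linarith)).mul_left _
    refine h2.of_norm_bounded_eventually_nat ?_
    filter_upwards [Filter.eventually_ge_atTop 1] with q hq
    have hq' : (1 : ℝ) ≤ q := by exact_mod_cast hq
    rw [Real.norm_of_nonneg (by positivity), Real.mul_rpow (by norm_num) (by positivity),
      ← Real.rpow_mul (by positivity), sub_eq_add_neg, Real.rpow_add (by positivity),
      Real.rpow_natCast, neg_mul]
    have : ((q : ℝ) + 3) ^ d ≤ 4 ^ d * (q : ℝ) ^ d := by
      rw [← mul_pow]; gcongr; linarith
    calc _ ≤ (4 ^ d * (q : ℝ) ^ d) * (2 ^ s * (q : ℝ) ^ (-(τ * s))) := by gcongr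
      _ = _ := by ring
  exact hsum.tsum_ofReal_ne_top

/-- The convergence half: simultaneously `q ^ (1 - τ)`-approximable points of the unit cube form
a set of Hausdorff dimension at most `(d + 1) / τ`. -/
theorem dimH_wellApproximable_le (d : ℕ) {τ : ℝ} (hτ : 1 ≤ τ) :
    dimH {x : Fin d → ℝ | (∀ j, x j ∈ Set.Ico (0 : ℝ) 1) ∧
        {q : ℕ | ∃ p : Fin d → ℤ, ∀ j,
          |(q : ℝ) * x j - (p j : ℝ)| ≤ (q : ℝ) ^ (1 - τ)}.Infinite} ≤
      ENNReal.ofReal (((d : ℝ) + 1) / τ) := by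
  have hτ0 : 0 < τ := by linarith
  refine dimH_le fun s hs => ?_
  by_contra hlt
  push Not at hlt
  have hds : (d : ℝ) + 1 < τ * s := by
    rw [← ENNReal.ofReal_coe_nnreal, ENNReal.ofReal_lt_ofReal_iff_of_nonneg (by positivity),
      div_lt_iff₀ hτ0] at hlt
    linarith
  have hspos : 0 < (s : ℝ) := by
    by_contra hs0
    have : (0 : ℝ) ≤ s := s.2
    have : (s : ℝ) = 0 := by linarith
    rw [this] at hds
    have : (0 : ℝ) ≤ d := d.cast_nonneg
    linarith
  set w : ℕ → ENNReal := fun q =>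
    ENNReal.ofReal (((q : ℝ) + 3) ^ d * (2 * (q : ℝ) ^ (-τ)) ^ (s : ℝ))
    with hw
  have htend : Filter.Tendsto (fun n => ∑' q, w (q + n)) Filter.atTop (nhds 0) :=
    ENNReal.tendsto_sum_nat_add w (tsum_weight_ne_top d hds)
  let t : ∀ n : ℕ, (Σ q : ℕ, (Fin d → Fin (q + n + 3))) → Set (Fin d → ℝ) := fun n i =>
    Metric.closedBall (fun j => (((i.2 j : ℕ) : ℝ) - 1) / ((i.1 + n : ℕ) : ℝ))
      (((i.1 + n : ℕ) : ℝ) ^ (-τ))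
  have hdiam : ∀ n i, Metric.ediam (t n i) ≤ ENNReal.ofReal (2 * ((i.1 + n : ℕ) : ℝ) ^ (-τ)) := by
    intro n i
    rw [ENNReal.ofReal_mul (by norm_num)]
    simp only [t]
    rw [← Metric.closedEBall_ofReal (by positivity)]
    refine Metric.ediam_closedEBall_le.trans ?_
    simp
  have hzero : μH[(s : ℝ)] {x : Fin d → ℝ | (∀ j, x j ∈ Set.Ico (0 : ℝ) 1) ∧
        {q : ℕ | ∃ p : Fin d → ℤ, ∀ j,
          |(q : ℝ) * x j - (p j : ℝ)| ≤ (q : ℝ) ^ (1 - τ)}.Infinite} ≤ 0 := by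
    refine (Measure.hausdorffMeasure_le_liminf_tsum (s : ℝ) _ (l := Filter.atTop)
      (fun n : ℕ => ENNReal.ofReal (2 * (n : ℝ) ^ (-τ))) ?_ t ?_ ?_).trans ?_
    · have : Filter.Tendsto (fun n : ℕ => 2 * (n : ℝ) ^ (-τ)) Filter.atTop (nhds (2 * 0)) :=
        ((tendsto_rpow_neg_atTop hτ0).comp tendsto_natCast_atTop_atTop).const_mul 2
      simpa using ENNReal.tendsto_ofReal this
    · filter_upwards [Filter.eventually_ge_atTop 1] with n hn i
      refine (hdiam n i).trans (ENNReal.ofReal_le_ofReal ?_)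
      have : (0 : ℝ) < n := by exact_mod_cast hn
      refine mul_le_mul_of_nonneg_left ?_ (by norm_num)
      exact Real.rpow_le_rpow_of_nonpos this (by push_cast; linarith [i.1.cast_nonneg (α := ℝ)])
        (by linarith)
    · filter_upwards [Filter.eventually_ge_atTop 1] with n hn
      rintro x ⟨hx, hinf⟩
      obtain ⟨q, ⟨p, hp⟩, hq⟩ := hinf.exists_gt n
      have hq0 : (1 : ℝ) ≤ q := by exact_mod_cast (hn.trans hq.le)
      have hqle : (q : ℝ) ^ (1 - τ) ≤ 1 := Real.rpow_le_one_of_one_le_of_nonpos hq0 (by linarith)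
      have hrange : ∀ j, 0 ≤ p j + 1 ∧ p j + 1 < q + 3 := by
        intro j
        have h1 := abs_le.1 ((hp j).trans hqle)
        have h2 := hx j
        have h3 : 0 ≤ (q : ℝ) * x j := mul_nonneg (by linarith) h2.1
        have h4 : (q : ℝ) * x j ≤ q := by nlinarith [h2.2]
        constructor
        · have : (-1 : ℝ) ≤ p j := by linarith
          have : (-1 : ℤ) ≤ p j := by exact_mod_cast this
          linarith
        · have : (p j : ℝ) ≤ q + 1 := by linarith
          have : p j ≤ q + 1 := by exact_mod_cast this
          linarith
      obtain ⟨k, rfl⟩ : ∃ k, q = k + n := ⟨q - n, by omega⟩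
      simp only [Set.mem_iUnion]
      refine ⟨⟨k, fun j => ⟨(p j + 1).toNat, by have := hrange j; omega⟩⟩, ?_⟩
      simp only [t]
      rw [Metric.mem_closedBall, dist_pi_le_iff (by positivity)]
      intro j
      have hc : (((p j + 1).toNat : ℕ) : ℝ) = p j + 1 := by
        have := Int.toNat_of_nonneg (hrange j).1
        exact_mod_cast congrArg (Int.cast (R := ℝ)) this
      rw [hc, Real.dist_eq]
      have hqp : (0 : ℝ) < ((k + n : ℕ) : ℝ) := by linarith
      have : x j - ((p j : ℝ) + 1 - 1) / ((k + n : ℕ) : ℝ) =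
          (((k + n : ℕ) : ℝ) * x j - p j) / ((k + n : ℕ) : ℝ) := by field_simp; ring
      rw [this, abs_div, abs_of_pos hqp, div_le_iff₀ hqp]
      refine (hp j).trans_eq ?_
      rw [sub_eq_neg_add, Real.rpow_add hqp, Real.rpow_one]
    · rw [← htend.liminf_eq]
      refine Filter.liminf_le_liminf (Filter.Eventually.of_forall fun n => ?_)
      rw [ENNReal.tsum_sigma']
      refine ENNReal.tsum_le_tsum fun q => ?_
      have hb : ∀ b : Fin d → Fin (q + n + 3), Metric.ediam (t n ⟨q, b⟩) ^ (s : ℝ) ≤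
          ENNReal.ofReal ((2 * ((q + n : ℕ) : ℝ) ^ (-τ)) ^ (s : ℝ)) := by
        intro b
        rw [← ENNReal.ofReal_rpow_of_nonneg (by positivity) hspos.le]
        exact ENNReal.rpow_le_rpow (hdiam n ⟨q, b⟩) hspos.le
      refine (ENNReal.tsum_le_tsum hb).trans ?_
      rw [tsum_fintype, Finset.sum_const, Finset.card_univ, Fintype.card_fun, Fintype.card_fin,
        Fintype.card_fin, nsmul_eq_mul, hw]
      simp only
      rw [ENNReal.ofReal_mul (by positivity)]
      refine le_of_eq ?_
      congr 1
      rw [← ENNReal.ofReal_natCast]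
      push_cast
      rfl
  rw [nonpos_iff_eq_zero.1 hzero] at hs
  exact ENNReal.zero_ne_top hs

theorem le_card_Icc_ceil_floor (l u : ℝ) : u - l - 1 ≤ ((Finset.Icc ⌈l⌉ ⌊u⌋).card : ℝ) := by
  rw [Int.card_Icc]
  have h1 := Int.ceil_lt_add_one l
  have h2 := Int.sub_one_lt_floor u
  have h3 : ((⌊u⌋ + 1 - ⌈l⌉ : ℤ) : ℝ) ≤ (((⌊u⌋ + 1 - ⌈l⌉).toNat : ℤ) : ℝ) := by
    exact_mod_cast Int.self_le_toNat _
  push_cast at h3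
  linarith

theorem card_Icc_ceil_floor_le {l u : ℝ} (h : l ≤ u) :
    ((Finset.Icc ⌈l⌉ ⌊u⌋).card : ℝ) ≤ u - l + 1 := by
  rw [Int.card_Icc]
  have h1 := Int.le_ceil l
  have h2 := Int.floor_le u
  have h3 : (((⌊u⌋ + 1 - ⌈l⌉).toNat : ℤ) : ℝ) ≤ u - l + 1 := by
    rw [Int.toNat_eq_max]
    push_cast
    exact max_le (by linarith) (by linarith)
  exact_mod_cast h3

/-- The rational point with denominator `q` and even numerators `2 * a j`. -/
noncomputable def evenPoint {d : ℕ} (q : ℕ) (a : Fin d → ℤ) : Fin d → ℝ :=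
  fun j => 2 * (a j : ℝ) / q

/-- The numerators `a` for which `evenPoint q a` is within distance `h` of `x`. -/
noncomputable def evenBox {d : ℕ} (x : Fin d → ℝ) (h : ℝ) (q : ℕ) : Finset (Fin d → ℤ) :=
  Fintype.piFinset fun j => Finset.Icc ⌈q * (x j - h) / 2⌉ ⌊q * (x j + h) / 2⌋

theorem mem_evenBox {d : ℕ} {x : Fin d → ℝ} {h : ℝ} (hh : 0 ≤ h) {q : ℕ} (hq : 0 < q)
    {a : Fin d → ℤ} : a ∈ evenBox x h q ↔ dist (evenPoint q a) x ≤ h := by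
  have hq' : (0 : ℝ) < q := by exact_mod_cast hq
  rw [evenBox, Fintype.mem_piFinset, dist_pi_le_iff hh]
  refine forall_congr' fun j => ?_
  rw [Finset.mem_Icc, Int.ceil_le, Int.le_floor, Real.dist_eq, abs_le, evenPoint,
    neg_le_sub_iff_le_add, sub_le_iff_le_add, div_le_iff₀ hq', ← sub_le_iff_le_add,
    le_div_iff₀ hq', div_le_iff₀ two_pos, le_div_iff₀ two_pos]
  constructor <;> rintro ⟨h1, h2⟩ <;> constructor <;> linarith

theorem le_card_evenBox {d : ℕ} (x : Fin d → ℝ) {h c : ℝ} {q : ℕ} (hc : 0 ≤ c)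
    (hq : c + 1 ≤ q * h) : c ^ d ≤ ((evenBox x h q).card : ℝ) := by
  rw [evenBox, Fintype.card_piFinset, Nat.cast_prod]
  calc c ^ d = ∏ _j : Fin d, c := by simp
    _ ≤ _ := by
      refine Finset.prod_le_prod (fun _ _ => hc) fun j _ => ?_
      refine le_trans ?_ (le_card_Icc_ceil_floor _ _)
      linarith

theorem card_evenBox_le {d : ℕ} (x : Fin d → ℝ) {h c : ℝ} {q : ℕ} (hh : 0 ≤ h)
    (hq : q * h + 1 ≤ c) : ((evenBox x h q).card : ℝ) ≤ c ^ d := by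
  rw [evenBox, Fintype.card_piFinset, Nat.cast_prod]
  calc _ ≤ ∏ _j : Fin d, c := by
        refine Finset.prod_le_prod (fun _ _ => by positivity) fun j _ => ?_
        have h0 : (0 : ℝ) ≤ q * h := by positivity
        refine (card_Icc_ceil_floor_le (by linarith)).trans ?_
        linarith
    _ = c ^ d := by simp

theorem Int.mul_sub_mul_ne_zero_of_prime {p q : ℕ} (hp : p.Prime) (hq : q.Prime) (hpq : p ≠ q)
    {a b : ℤ} (h0 : a ≠ 0) (h1 : |a| < p) : a * q - b * p ≠ 0 := by
  intro h
  have hdvd : (p : ℤ) ∣ a * q := ⟨b, by linarith⟩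
  have hcop : IsCoprime (p : ℤ) (q : ℤ) :=
    Nat.isCoprime_iff_coprime.2 ((Nat.coprime_primes hp hq).2 hpq)
  exact h0 (Int.eq_zero_of_abs_lt_dvd (hcop.dvd_of_dvd_mul_right hdvd) h1)

/-- Rational points with distinct prime denominators, having all coordinates in `(0, 1)`, are
rarely close to each other. -/
theorem card_close_evenPoint_le {d : ℕ} {x : Fin d → ℝ} {h r : ℝ} (hh : 0 ≤ h) (hr : 0 ≤ r)
    (hx : ∀ j, h < x j ∧ x j + h < 1) {M p q : ℕ} (hp : p.Prime) (hq : q.Prime) (hpq : p ≠ q)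
    (hpM : p < 2 * M) (hqM : q < 2 * M) :
    (({ab ∈ evenBox x h p ×ˢ evenBox x h q |
      dist (evenPoint p ab.1) (evenPoint q ab.2) ≤ r}).card : ℝ) ≤ (4 * r * (M : ℝ) ^ 2) ^ d := by
  have hp0 : (0 : ℝ) < p := by exact_mod_cast hp.pos
  have hq0 : (0 : ℝ) < q := by exact_mod_cast hq.pos
  have hpM' : (p : ℝ) ≤ 2 * M := by exact_mod_cast hpM.le
  have hqM' : (q : ℝ) ≤ 2 * M := by exact_mod_cast hqM.le
  set L : ℤ := ⌊2 * r * (M : ℝ) ^ 2⌋ with hL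
  have hL0 : 0 ≤ L := Int.floor_nonneg.2 (by positivity)
  have hbox : ∀ {q : ℕ}, 0 < q → ∀ a ∈ evenBox x h q, ∀ j, 0 < a j ∧ 2 * a j < q := by
    intro q hq a ha j
    have hq' : (0 : ℝ) < q := by exact_mod_cast hq
    have h1 := (dist_pi_le_iff hh).1 ((mem_evenBox hh hq).1 ha) j
    rw [Real.dist_eq, abs_le, evenPoint] at h1
    have h2 := hx j
    have h3 : 0 < 2 * (a j : ℝ) / q := by linarith
    have h4 : 2 * (a j : ℝ) / q < 1 := by linarith
    rw [div_lt_one hq'] at h4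
    have h5 : 0 < (a j : ℝ) := by
      by_contra hcon
      exact h3.not_ge (div_nonpos_of_nonpos_of_nonneg (by linarith) hq'.le)
    exact ⟨by exact_mod_cast h5, by exact_mod_cast h4⟩
  have hcard : (Fintype.piFinset fun _ : Fin d => (Finset.Icc (-L) L).erase 0).card =
      (2 * L).toNat ^ d := by
    rw [Fintype.card_piFinset_const, Finset.card_erase_of_mem (by simp [hL0]), Int.card_Icc]
    congr 1
    · omega
  have hcardle : ((2 * L).toNat : ℝ) ≤ 4 * r * (M : ℝ) ^ 2 := by
    have h1 : (((2 * L).toNat : ℤ) : ℝ) = 2 * (L : ℝ) := by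
      rw [Int.toNat_of_nonneg (by omega)]; push_cast; ring
    have h2 : (L : ℝ) ≤ 2 * r * (M : ℝ) ^ 2 := Int.floor_le _
    have h3 : ((2 * L).toNat : ℝ) = (((2 * L).toNat : ℤ) : ℝ) := by push_cast; rfl
    rw [h3, h1]
    linarith
  refine le_trans ?_ (pow_le_pow_left₀ (by positivity) hcardle d)
  rw [← Nat.cast_pow, ← hcard, Nat.cast_le]
  refine Finset.card_le_card_of_injOn (fun ab j => ab.1 j * q - ab.2 j * p) ?_ ?_
  · rintro ⟨a, b⟩ hab
    simp only [Finset.coe_filter, Finset.mem_product, Set.mem_ofPred_eq] at hab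
    obtain ⟨⟨ha, hb⟩, hdist⟩ := hab
    simp only [Finset.mem_coe, Fintype.mem_piFinset, Finset.mem_erase, Finset.mem_Icc]
    intro j
    have hj := hbox hp.pos a ha j
    refine ⟨Int.mul_sub_mul_ne_zero_of_prime hp hq hpq hj.1.ne' (by
      rw [abs_of_pos hj.1]; omega), ?_⟩
    rw [← abs_le, hL, Int.le_floor]
    have h1 := (dist_pi_le_iff hr).1 hdist j
    rw [Real.dist_eq, evenPoint, evenPoint] at h1
    have h2 : ((a j * q - b j * p : ℤ) : ℝ) =
        (2 * (a j : ℝ) / p - 2 * (b j : ℝ) / q) * (p * q / 2) := by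
      push_cast; field_simp
    rw [Int.cast_abs, h2, abs_mul, abs_of_pos (by positivity : (0 : ℝ) < p * q / 2)]
    calc _ ≤ r * (2 * M * (2 * M) / 2) := by gcongr
      _ = _ := by ring
  · rintro ⟨a, b⟩ hab ⟨a', b'⟩ hab' heq
    simp only [Finset.coe_filter, Finset.mem_product, Set.mem_ofPred_eq] at hab hab'
    have key : ∀ j, a j = a' j ∧ b j = b' j := by
      intro j
      have h1 := hbox hp.pos a hab.1.1 j
      have h2 := hbox hp.pos a' hab'.1.1 j
      have h3 : a j * q - b j * p = a' j * q - b' j * p := congrFun heq j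
      have h4 : a j = a' j := by
        by_contra hne
        refine Int.mul_sub_mul_ne_zero_of_prime hp hq hpq (a := a j - a' j) (b := b j - b' j)
          (sub_ne_zero.2 hne) (by rw [abs_lt]; omega) (by linarith)
      refine ⟨h4, ?_⟩
      rw [h4] at h3
      exact mul_right_cancel₀ (Nat.cast_ne_zero.2 hp.pos.ne' : (p : ℤ) ≠ 0) (by linarith)
    exact Prod.ext (funext fun j => (key j).1) (funext fun j => (key j).2)

theorem two_div_le_dist_evenPoint {d : ℕ} (q : ℕ) {a b : Fin d → ℤ} (h : a ≠ b) :
    2 / (q : ℝ) ≤ dist (evenPoint q a) (evenPoint q b) := by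
  obtain ⟨j, hj⟩ := Function.ne_iff.1 h
  refine le_trans ?_ (dist_le_pi_dist _ _ j)
  rw [Real.dist_eq, evenPoint, evenPoint, ← sub_div, ← mul_sub, abs_div, abs_mul,
    Nat.abs_cast, Nat.abs_ofNat]
  have h1 : (1 : ℝ) ≤ |(a j : ℝ) - b j| := by
    exact_mod_cast Int.one_le_abs (sub_ne_zero.2 hj)
  gcongr
  linarith

/-- Inside a fixed cube, a positive proportion of the expected number of rational points with
prime denominators in `[M, 2 * M)` and even numerators can be chosen to be well separated. -/
theorem eventually_exists_separated_evenPoint {d : ℕ} (hd : 1 ≤ d) {ε δ : ℝ} (hε : 0 < ε)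
    (hδ : 0 < δ) :
    ∀ᶠ M : ℕ in Filter.atTop, ∀ x : Fin d → ℝ, (∀ j, δ / 2 < x j ∧ x j + δ / 2 < 1) →
      ∀ Q : Finset ℕ, (∀ q ∈ Q, q.Prime ∧ M ≤ q ∧ q < 2 * M) →
      ∃ S : Finset (Fin d → ℝ), S.card = ⌈(Q.card : ℝ) * (M * δ / 16) ^ d⌉₊ ∧
        (∀ y ∈ S, dist y x ≤ δ / 2 ∧ ∃ q ∈ Q, ∃ a, y = evenPoint q a) ∧
        ∀ y ∈ S, ∀ z ∈ S, y ≠ z → (M : ℝ) ^ (-(((d : ℝ) + 1 + ε) / d)) < dist y z := by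
  classical
  have hd0 : (0 : ℝ) < d := by exact_mod_cast hd
  have hgap : 0 < (δ / 4) ^ d - (δ / 16) ^ d :=
    sub_pos.2 (pow_lt_pow_left₀ (by linarith) (by positivity) (by omega))
  have hev : ∀ᶠ M : ℕ in Filter.atTop, 4 ^ d * (M : ℝ) ^ (-ε) ≤ (δ / 4) ^ d - (δ / 16) ^ d := by
    have h1 : Filter.Tendsto (fun M : ℕ => 4 ^ d * (M : ℝ) ^ (-ε)) Filter.atTop
        (nhds (4 ^ d * 0)) :=
      ((tendsto_rpow_neg_atTop hε).comp tendsto_natCast_atTop_atTop).const_mul _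
    rw [mul_zero] at h1
    exact h1.eventually_le_const hgap
  filter_upwards [hev, Filter.eventually_ge_atTop 1,
    tendsto_natCast_atTop_atTop.eventually_ge_atTop (4 / δ)] with M hM hM1 hMδ x hx Q hQ
  rw [div_le_iff₀ hδ] at hMδ
  have hM1' : (1 : ℝ) ≤ M := by exact_mod_cast hM1
  have hM0 : (0 : ℝ) < M := by linarith
  set r : ℝ := (M : ℝ) ^ (-(((d : ℝ) + 1 + ε) / d)) with hr
  have hr0 : 0 < r := Real.rpow_pos_of_pos hM0 _
  have hrM : r ≤ 1 / M := by
    rw [one_div, ← Real.rpow_neg_one]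
    refine Real.rpow_le_rpow_of_exponent_le hM1' ?_
    rw [neg_le_neg_iff, le_div_iff₀ hd0]
    linarith
  have hrd : (4 * r * (M : ℝ) ^ 2) ^ d * M = 4 ^ d * (M : ℝ) ^ (-ε) * M ^ d := by
    have h1 : r ^ d = (M : ℝ) ^ (-((d : ℝ) + 1 + ε)) := by
      rw [hr, ← Real.rpow_natCast, ← Real.rpow_mul hM0.le]
      congr 1
      field_simp
    have h2 : (M : ℝ) ^ (-((d : ℝ) + 1 + ε)) = (M : ℝ) ^ (-ε) / (M ^ d * M) := by
      rw [eq_div_iff (by positivity), ← Real.rpow_natCast, ← Real.rpow_add_one hM0.ne',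
        ← Real.rpow_add hM0]
      congr 1
      ring
    rw [mul_pow, mul_pow, h1, h2, ← pow_mul, mul_comm 2 d, pow_mul]
    field_simp
  have hQM : (Q.card : ℝ) ≤ M := by
    have h1 : Q ⊆ Finset.Ico M (2 * M) := fun q hq => by
      have := hQ q hq; rw [Finset.mem_Ico]; exact this.2
    have h2 := Finset.card_le_card h1
    rw [Nat.card_Ico] at h2
    exact_mod_cast (by omega : Q.card ≤ M)
  set I : Finset (Σ _ : ℕ, (Fin d → ℤ)) := Q.sigma fun q => evenBox x (δ / 2) q with hI
  set f : (Σ _ : ℕ, (Fin d → ℤ)) → (Fin d → ℝ) := fun i => evenPoint i.1 i.2 with hf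
  set B := {i ∈ I | ∃ i' ∈ I, i.1 ≠ i'.1 ∧ dist (f i) (f i') ≤ r} with hB
  have hIcard : (Q.card : ℝ) * (M * δ / 4) ^ d ≤ I.card := by
    rw [hI, Finset.card_sigma, Nat.cast_sum, ← nsmul_eq_mul]
    refine Finset.card_nsmul_le_sum _ _ _ fun q hq => ?_
    refine le_card_evenBox x (by positivity) ?_
    have : (M : ℝ) ≤ q := by exact_mod_cast (hQ q hq).2.1
    nlinarith
  have hBcard : (B.card : ℝ) ≤ Q.card * (Q.card * (4 * r * (M : ℝ) ^ 2) ^ d) := by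
    have hsub : B ⊆ Q.offDiag.biUnion fun pq =>
        ({ab ∈ evenBox x (δ / 2) pq.1 ×ˢ evenBox x (δ / 2) pq.2 |
          dist (evenPoint pq.1 ab.1) (evenPoint pq.2 ab.2) ≤ r}).image
          fun ab => (⟨pq.1, ab.1⟩ : Σ _ : ℕ, (Fin d → ℤ)) := by
      intro i hi
      simp only [hB, hI, hf, Finset.mem_filter, Finset.mem_sigma] at hi
      obtain ⟨hi1, i', hi', hne, hdist⟩ := hi
      simp only [Finset.mem_biUnion, Finset.mem_offDiag, Finset.mem_image, Finset.mem_filter,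
        Finset.mem_product]
      exact ⟨(i.1, i'.1), ⟨hi1.1, hi'.1, hne⟩, (i.2, i'.2), ⟨⟨hi1.2, hi'.2⟩, hdist⟩, rfl⟩
    calc (B.card : ℝ) ≤ ∑ pq ∈ Q.offDiag, (4 * r * (M : ℝ) ^ 2) ^ d := by
          refine (Nat.cast_le.2 ((Finset.card_le_card hsub).trans Finset.card_biUnion_le)).trans ?_
          rw [Nat.cast_sum]
          refine Finset.sum_le_sum fun pq hpq => ?_
          rw [Finset.mem_offDiag] at hpq
          have h1 := hQ _ hpq.1
          have h2 := hQ _ hpq.2.1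
          exact (Nat.cast_le.2 Finset.card_image_le).trans
            (card_close_evenPoint_le (by positivity) hr0.le hx h1.1 h2.1 hpq.2.2 h1.2.2 h2.2.2)
      _ = (Q.offDiag.card : ℝ) * (4 * r * (M : ℝ) ^ 2) ^ d := by
          rw [Finset.sum_const, nsmul_eq_mul]
      _ ≤ ((Q.card * Q.card : ℕ) : ℝ) * (4 * r * (M : ℝ) ^ 2) ^ d := by
          gcongr
          rw [Finset.offDiag_card]
          omega
      _ = _ := by push_cast; ring
  have hsep : ∀ i ∈ I \ B, ∀ i' ∈ I \ B, i ≠ i' → r < dist (f i) (f i') := by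
    intro i hi i' hi' hne
    rw [Finset.mem_sdiff] at hi hi'
    by_cases hq : i.1 = i'.1
    · obtain ⟨q, a⟩ := i
      obtain ⟨q', b⟩ := i'
      obtain rfl : q = q' := hq
      have hab : a ≠ b := fun h => hne (by rw [h])
      have h1 := hQ q (Finset.mem_sigma.1 hi.1).1
      have h2 : (q : ℝ) < 2 * M := by exact_mod_cast h1.2.2
      have h3 : (0 : ℝ) < q := by exact_mod_cast h1.1.pos
      calc r ≤ 1 / M := hrM
        _ = 2 / (2 * M) := by field_simp
        _ < 2 / q := by gcongr
        _ ≤ _ := two_div_le_dist_evenPoint q hab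
    · by_contra hcon
      exact hi.2 (Finset.mem_filter.2 ⟨hi.1, i', hi'.1, hq, not_lt.1 hcon⟩)
  have hinj : Set.InjOn f (I \ B : Finset _) := by
    intro i hi i' hi' heq
    by_contra hne
    have := hsep i hi i' hi' hne
    rw [heq, dist_self] at this
    linarith
  have hgood : ⌈(Q.card : ℝ) * (M * δ / 16) ^ d⌉₊ ≤ ((I \ B).image f).card := by
    rw [Nat.ceil_le, Finset.card_image_of_injOn hinj]
    have h1 : (I.card : ℝ) - B.card ≤ (I \ B).card := by
      rw [sub_le_iff_le_add]
      exact_mod_cast (Finset.card_le_card_sdiff_add_card (s := I) (t := B))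
    have h2 : Q.card * (Q.card * (4 * r * (M : ℝ) ^ 2) ^ d) ≤
        Q.card * (((δ / 4) ^ d - (δ / 16) ^ d) * M ^ d) := by
      have h3 : Q.card * (4 * r * (M : ℝ) ^ 2) ^ d ≤ (4 * r * (M : ℝ) ^ 2) ^ d * M := by
        rw [mul_comm]; gcongr
      rw [hrd] at h3
      have h4 := mul_le_mul_of_nonneg_right hM (by positivity : (0 : ℝ) ≤ M ^ d)
      exact mul_le_mul_of_nonneg_left (h3.trans h4) (by positivity)
    have h5 : (M * δ / 4) ^ d = (δ / 4) ^ d * (M : ℝ) ^ d := by rw [← mul_pow]; ring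
    have h6 : (M * δ / 16) ^ d = (δ / 16) ^ d * (M : ℝ) ^ d := by rw [← mul_pow]; ring
    rw [h5] at hIcard
    rw [h6]
    linarith
  obtain ⟨S, hS, hScard⟩ := Finset.exists_subset_card_eq hgood
  refine ⟨S, hScard, fun y hy => ?_, fun y hy z hz hyz => ?_⟩
  · obtain ⟨i, hi, rfl⟩ := Finset.mem_image.1 (hS hy)
    have h1 := Finset.mem_sigma.1 (Finset.mem_sdiff.1 hi).1
    exact ⟨(mem_evenBox (by positivity) (hQ _ h1.1).1.pos).1 h1.2, i.1, h1.1, i.2, rfl⟩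
  · obtain ⟨i, hi, rfl⟩ := Finset.mem_image.1 (hS hy)
    obtain ⟨i', hi', rfl⟩ := Finset.mem_image.1 (hS hz)
    exact hsep i hi i' hi' fun h => hyz (by rw [h])

theorem card_le_of_separated {d : ℕ} {S : Finset (Fin d → ℝ)} {r R : ℝ} (hr : 0 < r)
    (hR : 0 ≤ R) (hsep : ∀ y ∈ S, ∀ z ∈ S, y ≠ z → r < dist y z) (u : Fin d → ℝ)
    (hS : ∀ y ∈ S, dist y u ≤ R) : (S.card : ℝ) ≤ (2 * R / r + 2) ^ d := by
  have hinj : S.card ≤ (Fintype.piFinset fun j : Fin d =>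
      Finset.Icc ⌊(u j - R) / r⌋ ⌊(u j + R) / r⌋).card := by
    refine Finset.card_le_card_of_injOn (fun y j => ⌊y j / r⌋) ?_ ?_
    · intro y hy
      simp only [Finset.mem_coe, Fintype.mem_piFinset, Finset.mem_Icc]
      intro j
      have h1 := (dist_pi_le_iff hR).1 (hS y hy) j
      rw [Real.dist_eq, abs_le] at h1
      constructor <;> gcongr <;> linarith
    · intro y hy z hz heq
      by_contra hne
      refine (hsep y hy z hz hne).not_ge ((dist_pi_le_iff hr.le).2 fun j => ?_)
      have h1 := Int.abs_sub_lt_one_of_floor_eq_floor (congrFun heq j)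
      rw [← sub_div, abs_div, abs_of_pos hr, div_lt_one hr] at h1
      exact h1.le
  refine (Nat.cast_le.2 hinj).trans ?_
  rw [Fintype.card_piFinset, Nat.cast_prod]
  calc _ ≤ ∏ _j : Fin d, (2 * R / r + 2) := by
        refine Finset.prod_le_prod (fun _ _ => by positivity) fun j _ => ?_
        rw [Int.card_Icc]
        have h1 := Int.sub_one_lt_floor ((u j - R) / r)
        have h2 := Int.floor_le ((u j + R) / r)
        have h3 : (u j + R) / r - (u j - R) / r = 2 * R / r := by ring
        have h4 : (((⌊(u j + R) / r⌋ + 1 - ⌊(u j - R) / r⌋).toNat : ℤ) : ℝ) ≤ 2 * R / r + 2 := by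
          rw [Int.toNat_eq_max]
          push_cast
          exact max_le (by linarith) (by positivity)
        exact_mod_cast h4
    _ = _ := by simp

theorem card_le_of_evenPoint {d : ℕ} {S : Finset (Fin d → ℝ)} {Q : Finset ℕ} {R c : ℝ}
    (hR : 0 ≤ R) (hQ : ∀ q ∈ Q, 0 < q ∧ q * R + 1 ≤ c) (u : Fin d → ℝ)
    (hS : ∀ y ∈ S, dist y u ≤ R ∧ ∃ q ∈ Q, ∃ a, y = evenPoint q a) :
    (S.card : ℝ) ≤ Q.card * c ^ d := by
  classical
  have hsub : S ⊆ Q.biUnion fun q => (evenBox u R q).image (evenPoint q) := by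
    intro y hy
    obtain ⟨h1, q, hq, a, rfl⟩ := hS y hy
    exact Finset.mem_biUnion.2 ⟨q, hq, Finset.mem_image_of_mem _
      ((mem_evenBox hR (hQ q hq).1).2 h1)⟩
  refine (Nat.cast_le.2 ((Finset.card_le_card hsub).trans Finset.card_biUnion_le)).trans ?_
  rw [Nat.cast_sum, ← nsmul_eq_mul]
  exact Finset.sum_le_card_nsmul _ _ _ fun q hq =>
    (Nat.cast_le.2 Finset.card_image_le).trans (card_evenBox_le u hR (hQ q hq).2)

/-- A stage of the Cantor construction: centres `F` of disjoint balls of radius `δ` in the open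
unit cube, which are numerous enough for the `s`-dimensional mass estimate. -/
structure IsCantorStage (d : ℕ) (A s : ℝ) (F : Finset (Fin d → ℝ)) (δ : ℝ) : Prop where
  nonempty : F.Nonempty
  pos : 0 < δ
  inside : ∀ x ∈ F, ∀ j, δ < x j ∧ x j + δ < 1
  separated : ∀ x ∈ F, ∀ y ∈ F, x ≠ y → 2 * δ < dist x y
  mass : 80 ^ d ≤ A * F.card * δ ^ s

/-- The relation between consecutive stages `(F, δ)` and `(F', δ')` of the Cantor construction,
with denominators at least `n` at the latter stage. -/
structure IsCantorStep (d : ℕ) (A s τ : ℝ) (n : ℕ) (F : Finset (Fin d → ℝ)) (δ : ℝ)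
    (F' : Finset (Fin d → ℝ)) (δ' : ℝ) : Prop where
  radius_le : δ' ≤ δ / 2
  nested : (⋃ y ∈ F', Metric.closedBall y δ') ⊆ ⋃ x ∈ F, Metric.closedBall x δ
  equidistributed : ∀ U : Set (Fin d → ℝ), ∀ S' ⊆ F',
    (∀ y ∈ S', (Metric.closedBall y δ' ∩ U).Nonempty) →
    ∃ S ⊆ F, (∀ x ∈ S, (Metric.closedBall x δ ∩ U).Nonempty) ∧
      S'.card * F.card ≤ S.card * F'.card
  mass_le : ∀ u ρ, δ' ≤ ρ → ρ ≤ δ → ∀ S ⊆ F',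
    (∀ y ∈ S, (Metric.closedBall y δ' ∩ Metric.closedBall u ρ).Nonempty) →
    (S.card : ℝ) ≤ A * ρ ^ s * F'.card
  approx : ∀ y ∈ F', ∃ q, n ≤ q ∧ Odd q ∧ (∃ a, y = evenPoint q a) ∧ δ' ≤ (q : ℝ) ^ (-τ)

theorem eventually_le_natCast_rpow {η : ℝ} (hη : 0 < η) (C : ℝ) :
    ∀ᶠ M : ℕ in Filter.atTop, C ≤ (M : ℝ) ^ η :=
  ((tendsto_rpow_atTop hη).comp tendsto_natCast_atTop_atTop).eventually_ge_atTop C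

theorem exists_cantorStep {d : ℕ} (hd : 1 ≤ d) {A s τ : ℝ} (hA : 0 < A) (hs : 0 < s)
    (hsd : s < d) (hτs : τ * s < d + 1) (hτ : ((d : ℝ) + 1) / d < τ) (n : ℕ)
    {F : Finset (Fin d → ℝ)} {δ : ℝ} (hF : IsCantorStage d A s F δ) :
    ∃ F' δ', IsCantorStage d A s F' δ' ∧ IsCantorStep d A s τ n F δ F' δ' := by
  classical
  have hd0 : (0 : ℝ) < d := by exact_mod_cast hd
  have hδ := hF.pos
  have hτ1 : 1 < τ := lt_trans (by rw [lt_div_iff₀ hd0]; linarith) hτ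
  rw [div_lt_iff₀ hd0] at hτ
  obtain ⟨ε, hε, hε1, hε2, hε3⟩ : ∃ ε : ℝ, 0 < ε ∧ 0 < d + 1 - ε - τ * s ∧ 0 < d - s - 2 * ε ∧
      d + 1 + ε < τ * d := by
    refine ⟨min (min (d + 1 - τ * s) (d - s)) (τ * d - (d + 1)) / 4, ?_, ?_, ?_, ?_⟩
    · have := lt_min (lt_min (sub_pos.2 hτs) (sub_pos.2 hsd)) (sub_pos.2 hτ)
      linarith
    all_goals
      have h1 := min_le_left (min (d + 1 - τ * s) (d - s)) (τ * d - (d + 1))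
      have h2 := min_le_right (min (d + 1 - τ * s) (d - s)) (τ * d - (d + 1))
      have h3 := min_le_left (d + 1 - τ * s) (d - s)
      have h4 := min_le_right (d + 1 - τ * s) (d - s)
      linarith
  have hFcard : (0 : ℝ) < F.card := by exact_mod_cast hF.nonempty.card_pos
  set B : ℝ := A * F.card * (δ / 16) ^ d with hB
  have hB0 : 0 < B := by positivity
  have hδev : ∀ᶠ M : ℕ in Filter.atTop, (2 * (M : ℝ)) ^ (-τ) ≤ δ / 2 := by
    have h1 : Filter.Tendsto (fun M : ℕ => 2 * (M : ℝ)) Filter.atTop Filter.atTop :=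
      tendsto_natCast_atTop_atTop.const_mul_atTop two_pos
    exact ((tendsto_rpow_neg_atTop (by linarith : 0 < τ)).comp h1).eventually_le_const
      (by positivity)
  obtain ⟨M, hprimes, hloc, hM2, hMn, hMδ, hδ', hE2, hE3⟩ :=
    ((frequently_rpow_le_card_primes hε).and_eventually
      ((eventually_exists_separated_evenPoint hd hε hδ).and
      ((Filter.eventually_ge_atTop 3).and ((Filter.eventually_ge_atTop n).and
      ((tendsto_natCast_atTop_atTop.eventually_ge_atTop (1 / δ)).and (hδev.and
      ((eventually_le_natCast_rpow hε1 (80 ^ d / (B * 2 ^ (-(τ * s))))).and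
      (eventually_le_natCast_rpow hε2 (6 ^ d / B))))))))).exists
  set Q := {p ∈ Finset.Ico M (2 * M) | p.Prime} with hQdef
  have hQ : ∀ q ∈ Q, q.Prime ∧ M ≤ q ∧ q < 2 * M := by
    intro q hq
    rw [hQdef, Finset.mem_filter, Finset.mem_Ico] at hq
    exact ⟨hq.2, hq.1⟩
  have hM1 : (1 : ℝ) ≤ M := by exact_mod_cast (by omega : 1 ≤ M)
  have hM0 : (0 : ℝ) < M := by linarith
  set r : ℝ := (M : ℝ) ^ (-(((d : ℝ) + 1 + ε) / d)) with hr
  have hr0 : 0 < r := Real.rpow_pos_of_pos hM0 _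
  have hrδ : r ≤ δ := by
    have h1 : r ≤ 1 / M := by
      rw [one_div, ← Real.rpow_neg_one]
      refine Real.rpow_le_rpow_of_exponent_le hM1 ?_
      rw [neg_le_neg_iff, le_div_iff₀ hd0]
      linarith
    exact h1.trans ((one_div_le hM0 hδ).2 hMδ)
  have hrd : r ^ d * (M : ℝ) ^ ((d : ℝ) + 1 + ε) = 1 := by
    rw [hr, ← Real.rpow_natCast, ← Real.rpow_mul hM0.le, ← Real.rpow_add hM0]
    rw [show -(((d : ℝ) + 1 + ε) / d) * d + (d + 1 + ε) = 0 by field_simp; ring, Real.rpow_zero]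
  set δ' : ℝ := (2 * (M : ℝ)) ^ (-τ) with hδ'def
  have hδ'0 : 0 < δ' := Real.rpow_pos_of_pos (by linarith) _
  have hδ'r : 2 * δ' < r := by
    have h1 : δ' < 2⁻¹ * (M : ℝ) ^ (-τ) := by
      rw [hδ'def, Real.mul_rpow (by norm_num) hM0.le, ← Real.rpow_neg_one 2]
      refine mul_lt_mul_of_pos_right ?_ (Real.rpow_pos_of_pos hM0 _)
      exact Real.rpow_lt_rpow_of_exponent_lt (by norm_num) (by linarith)
    have h2 : (M : ℝ) ^ (-τ) ≤ r := by
      refine Real.rpow_le_rpow_of_exponent_le hM1 ?_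
      rw [neg_le_neg_iff, div_le_iff₀ hd0]
      exact hε3.le
    linarith
  choose! T hTcard hTmem hTsep using fun x (hx : x ∈ F) => hloc x (fun j => by
    have := hF.inside x hx j
    constructor <;> linarith) Q hQ
  set N := ⌈(Q.card : ℝ) * (M * δ / 16) ^ d⌉₊ with hN
  have hQ0 : (0 : ℝ) < Q.card := (Real.rpow_pos_of_pos hM0 _).trans_le hprimes
  have hN0 : 0 < N := Nat.ceil_pos.2 (by positivity)
  have hdisj : ∀ x ∈ F, ∀ x' ∈ F, x ≠ x' → ∀ y ∈ T x, ∀ y' ∈ T x', δ < dist y y' := by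
    intro x hx x' hx' hne y hy y' hy'
    have h1 := hF.separated x hx x' hx' hne
    have h2 := (hTmem x hx y hy).1
    have h3 := (hTmem x' hx' y' hy').1
    have h4 := dist_triangle4 x y y' x'
    rw [dist_comm x y] at h4
    linarith
  set F' := F.biUnion T with hF'
  have hF'card : F'.card = F.card * N := by
    rw [hF', Finset.card_biUnion, Finset.sum_congr rfl hTcard, Finset.sum_const, smul_eq_mul]
    intro x hx x' hx' hne
    rw [Function.onFun, Finset.disjoint_left]
    intro y hy hy'
    have := hdisj x hx x' hx' hne y hy y hy'
    rw [dist_self] at this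
    linarith
  have hF'sep : ∀ y ∈ F', ∀ z ∈ F', y ≠ z → r < dist y z := by
    intro y hy z hz hne
    obtain ⟨x, hx, hy⟩ := Finset.mem_biUnion.1 hy
    obtain ⟨x', hx', hz⟩ := Finset.mem_biUnion.1 hz
    by_cases hxx : x = x'
    · subst hxx
      exact hTsep x hx y hy z hz hne
    · exact hrδ.trans_lt (hdisj x hx x' hx' hxx y hy z hz)
  have hF'Q : (F.card : ℝ) * (Q.card * (M * δ / 16) ^ d) ≤ F'.card := by
    rw [hF'card, Nat.cast_mul]
    exact mul_le_mul_of_nonneg_left (Nat.le_ceil _) hFcard.le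
  have hF'M : B * (M : ℝ) ^ ((d : ℝ) + 1 - ε) ≤ A * F'.card := by
    have h1 : (M : ℝ) ^ ((d : ℝ) + 1 - ε) = (M : ℝ) ^ (1 - ε) * (M : ℝ) ^ d := by
      rw [← Real.rpow_natCast, ← Real.rpow_add hM0]
      congr 1; ring
    have h2 : (M * δ / 16) ^ d = (M : ℝ) ^ d * (δ / 16) ^ d := by rw [← mul_pow]; ring
    calc B * (M : ℝ) ^ ((d : ℝ) + 1 - ε)
        = A * (F.card * ((M : ℝ) ^ (1 - ε) * (M * δ / 16) ^ d)) := by rw [h1, h2, hB]; ring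
      _ ≤ A * (F.card * (Q.card * (M * δ / 16) ^ d)) := by gcongr
      _ ≤ A * F'.card := by gcongr
  have hmass : 80 ^ d ≤ A * F'.card * δ' ^ s := by
    have h1 : δ' ^ s = 2 ^ (-(τ * s)) * (M : ℝ) ^ (-(τ * s)) := by
      rw [hδ'def, ← Real.rpow_mul (by positivity), Real.mul_rpow (by norm_num) hM0.le, neg_mul]
    rw [div_le_iff₀ (by positivity)] at hE2
    calc (80 : ℝ) ^ d ≤ (M : ℝ) ^ (d + 1 - ε - τ * s) * (B * 2 ^ (-(τ * s))) := hE2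
      _ = B * (M : ℝ) ^ ((d : ℝ) + 1 - ε) * δ' ^ s := by
        rw [h1, sub_eq_add_neg _ (τ * s), Real.rpow_add hM0]; ring
      _ ≤ _ := by gcongr
  refine ⟨F', δ', ⟨?_, hδ'0, ?_, fun y hy z hz hne => hδ'r.trans (hF'sep y hy z hz hne), hmass⟩,
    ⟨hδ', ?_, ?_, ?_, ?_⟩⟩
  · rw [← Finset.card_pos, hF'card]
    exact Nat.mul_pos hF.nonempty.card_pos hN0
  · intro y hy j
    obtain ⟨x, hx, hy⟩ := Finset.mem_biUnion.1 hy
    have h1 := (dist_pi_le_iff (by positivity)).1 (hTmem x hx y hy).1 j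
    have h2 := hF.inside x hx j
    rw [Real.dist_eq, abs_le] at h1
    constructor <;> linarith
  · refine Set.iUnion₂_subset fun y hy => ?_
    obtain ⟨x, hx, hy⟩ := Finset.mem_biUnion.1 hy
    refine Set.Subset.trans (Metric.closedBall_subset_closedBall' ?_)
      (Set.subset_biUnion_of_mem (u := fun x => Metric.closedBall x δ) hx)
    have := (hTmem x hx y hy).1
    linarith
  · intro U S' hS' hU
    refine ⟨{x ∈ F | ∃ y ∈ S', y ∈ T x}, Finset.filter_subset _ _, ?_, ?_⟩
    · intro x hx
      obtain ⟨hx, y, hyS, hy⟩ := Finset.mem_filter.1 hx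
      refine (hU y hyS).mono (Set.inter_subset_inter_left _
        (Metric.closedBall_subset_closedBall' ?_))
      have := (hTmem x hx y hy).1
      linarith
    · have h1 : S' ⊆ ({x ∈ F | ∃ y ∈ S', y ∈ T x}).biUnion T := by
        intro y hy
        obtain ⟨x, hx, hyx⟩ := Finset.mem_biUnion.1 (hS' hy)
        exact Finset.mem_biUnion.2 ⟨x, Finset.mem_filter.2 ⟨hx, y, hy, hyx⟩, hyx⟩
      have h2 : S'.card ≤ ({x ∈ F | ∃ y ∈ S', y ∈ T x}).card * N :=
        (Finset.card_le_card h1).trans (Finset.card_biUnion_le_card_mul _ _ _ fun x hx =>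
          (hTcard x (Finset.mem_filter.1 hx).1).le)
      rw [hF'card]
      calc _ ≤ ({x ∈ F | ∃ y ∈ S', y ∈ T x}).card * N * F.card := Nat.mul_le_mul_right _ h2
        _ = _ := by ring
  · intro u ρ hρ1 hρ2 S hS hSU
    have hρ0 : 0 < ρ := hδ'0.trans_le hρ1
    have hSu : ∀ y ∈ S, dist y u ≤ 2 * ρ := by
      intro y hy
      obtain ⟨z, hz1, hz2⟩ := hSU y hy
      rw [Metric.mem_closedBall] at hz1 hz2
      have := dist_triangle_left y u z
      linarith
    have hρd : ρ ^ d = ρ ^ s * ρ ^ ((d : ℝ) - s) := by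
      rw [← Real.rpow_add hρ0, ← Real.rpow_natCast]; congr 1; ring
    rcases le_total (1 / (M : ℝ)) ρ with hρM | hρM
    · rw [div_le_iff₀ hM0] at hρM
      refine (card_le_of_evenPoint (Q := Q) (R := 2 * ρ) (c := 5 * (M * ρ)) (by positivity)
        ?_ u fun y hy => ⟨hSu y hy, ?_⟩).trans ?_
      · intro q hq
        have h1 := hQ q hq
        have h2 : (q : ℝ) ≤ 2 * M := by exact_mod_cast h1.2.2.le
        refine ⟨h1.1.pos, ?_⟩
        nlinarith
      · obtain ⟨x, hx, hyx⟩ := Finset.mem_biUnion.1 (hS hy)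
        exact (hTmem x hx y hyx).2
      · have h1 : (5 : ℝ) ^ d * ρ ^ ((d : ℝ) - s) ≤ A * F.card * (δ / 16) ^ d := by
          have h2 : δ ^ d = δ ^ s * δ ^ ((d : ℝ) - s) := by
            rw [← Real.rpow_add hδ, ← Real.rpow_natCast]; congr 1; ring
          calc (5 : ℝ) ^ d * ρ ^ ((d : ℝ) - s) ≤ 5 ^ d * δ ^ ((d : ℝ) - s) := by
                have : 0 ≤ (d : ℝ) - s := by linarith
                gcongr
            _ = 80 ^ d * δ ^ ((d : ℝ) - s) / 16 ^ d := by
                rw [show (80 : ℝ) = 5 * 16 by norm_num, mul_pow]; field_simp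
            _ ≤ A * F.card * δ ^ s * δ ^ ((d : ℝ) - s) / 16 ^ d := by
                gcongr
                exact hF.mass
            _ = _ := by rw [div_pow, h2]; ring
        calc (Q.card : ℝ) * (5 * (M * ρ)) ^ d
            = Q.card * M ^ d * ρ ^ s * (5 ^ d * ρ ^ ((d : ℝ) - s)) := by
              rw [mul_pow, mul_pow, hρd]; ring
          _ ≤ Q.card * M ^ d * ρ ^ s * (A * F.card * (δ / 16) ^ d) := by gcongr
          _ = A * ρ ^ s * (F.card * (Q.card * (M * δ / 16) ^ d)) := by
              rw [mul_div_assoc, mul_pow]; ring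
          _ ≤ _ := by gcongr
    · refine (card_le_of_separated hr0 (by positivity : 0 ≤ 2 * ρ)
        (fun y hy z hz => hF'sep y (hS hy) z (hS hz)) u hSu).trans ?_
      rcases le_total ρ r with hρr | hρr
      · have h1 : 2 * (2 * ρ) / r ≤ 4 := by rw [div_le_iff₀ hr0]; linarith
        calc (2 * (2 * ρ) / r + 2) ^ d ≤ 80 ^ d := by
              gcongr
              linarith
          _ ≤ A * F'.card * δ' ^ s := hmass
          _ ≤ A * F'.card * ρ ^ s := by gcongr
          _ = _ := by ring
      · rw [div_le_iff₀ hB0] at hE3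
        have h1 : 2 * (2 * ρ) / r + 2 ≤ 6 * ρ / r := by
          rw [div_add' _ _ _ hr0.ne']; gcongr; linarith
        have h2 : ρ ^ ((d : ℝ) - s) ≤ (M : ℝ) ^ (s - d) := by
          rw [← neg_sub (d : ℝ) s, Real.rpow_neg hM0.le, ← Real.inv_rpow hM0.le, ← one_div]
          have : 0 ≤ (d : ℝ) - s := by linarith
          gcongr
        calc (2 * (2 * ρ) / r + 2) ^ d ≤ (6 * ρ / r) ^ d := by gcongr
          _ = 6 ^ d * ρ ^ s * (ρ ^ ((d : ℝ) - s) * (M : ℝ) ^ ((d : ℝ) + 1 + ε)) := by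
              rw [div_pow, mul_pow, hρd, div_eq_iff (by positivity)]
              linear_combination (-(6 ^ d * ρ ^ s * ρ ^ ((d : ℝ) - s))) * hrd
          _ ≤ 6 ^ d * ρ ^ s * ((M : ℝ) ^ (s - d) * (M : ℝ) ^ ((d : ℝ) + 1 + ε)) := by gcongr
          _ = 6 ^ d * ρ ^ s * (M : ℝ) ^ (s + 1 + ε) := by
              rw [← Real.rpow_add hM0]; congr 2; ring
          _ ≤ (M : ℝ) ^ ((d : ℝ) - s - 2 * ε) * B * ρ ^ s * (M : ℝ) ^ (s + 1 + ε) := by gcongr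
          _ = ρ ^ s * (B * (M : ℝ) ^ ((d : ℝ) + 1 - ε)) := by
              have h3 : (M : ℝ) ^ ((d : ℝ) + 1 - ε) =
                  (M : ℝ) ^ ((d : ℝ) - s - 2 * ε) * (M : ℝ) ^ (s + 1 + ε) := by
                rw [← Real.rpow_add hM0]; congr 1; ring
              rw [h3]; ring
          _ ≤ ρ ^ s * (A * F'.card) := by gcongr
          _ = _ := by ring
  · intro y hy
    obtain ⟨x, hx, hyx⟩ := Finset.mem_biUnion.1 hy
    obtain ⟨q, hq, a, rfl⟩ := (hTmem x hx y hyx).2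
    have h1 := hQ q hq
    refine ⟨q, hMn.trans h1.2.1, h1.1.odd_of_ne_two (by omega), ⟨a, rfl⟩, ?_⟩
    have h2 : (q : ℝ) ≤ 2 * M := by exact_mod_cast h1.2.2.le
    exact Real.rpow_le_rpow_of_nonpos (by exact_mod_cast h1.1.pos) h2 (by linarith)

theorem exists_seq_isCantorStep {d : ℕ} {A s τ : ℝ} (hd : 1 ≤ d) (hA : 0 < A) (hs : 0 < s)
    (hsd : s < d) (hτs : τ * s < d + 1) (hτ : ((d : ℝ) + 1) / d < τ) {F₀ : Finset (Fin d → ℝ)}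
    {δ₀ : ℝ} (h₀ : IsCantorStage d A s F₀ δ₀) :
    ∃ (F : ℕ → Finset (Fin d → ℝ)) (δ : ℕ → ℝ), F 0 = F₀ ∧ δ 0 = δ₀ ∧
      (∀ n, IsCantorStage d A s (F n) (δ n)) ∧
      ∀ n, IsCantorStep d A s τ n (F n) (δ n) (F (n + 1)) (δ (n + 1)) := by
  have hnext : ∀ (n : ℕ) (p : {p : Finset (Fin d → ℝ) × ℝ // IsCantorStage d A s p.1 p.2}),
      ∃ p' : {p : Finset (Fin d → ℝ) × ℝ // IsCantorStage d A s p.1 p.2},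
        IsCantorStep d A s τ n p.1.1 p.1.2 p'.1.1 p'.1.2 := by
    rintro n ⟨p, hp⟩
    obtain ⟨F', δ', hstage, hstep⟩ := exists_cantorStep hd hA hs hsd hτs hτ n hp
    exact ⟨⟨(F', δ'), hstage⟩, hstep⟩
  choose next hnext using hnext
  let seq : ℕ → {p : Finset (Fin d → ℝ) × ℝ // IsCantorStage d A s p.1 p.2} :=
    fun n => Nat.rec ⟨(F₀, δ₀), h₀⟩ next n
  exact ⟨fun n => (seq n).1.1, fun n => (seq n).1.2, rfl, rfl, fun n => (seq n).2,
    fun n => hnext n (seq n)⟩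

theorem IsCantorStep.card_le {d : ℕ} {A s τ : ℝ} {F : ℕ → Finset (Fin d → ℝ)} {δ : ℕ → ℝ}
    (hF0 : (F 0).card = 1)
    (hstage : ∀ n, IsCantorStage d A s (F n) (δ n))
    (hstep : ∀ n, IsCantorStep d A s τ n (F n) (δ n) (F (n + 1)) (δ (n + 1))) (n : ℕ)
    (u : Fin d → ℝ) (ρ : ℝ) (hρ : δ n ≤ ρ) (hρ0 : ρ ≤ δ 0) (S : Finset (Fin d → ℝ))
    (hSF : S ⊆ F n)
    (hS : ∀ y ∈ S, (Metric.closedBall y (δ n) ∩ Metric.closedBall u ρ).Nonempty) :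
    (S.card : ℝ) ≤ A * ρ ^ s * (F n).card := by
  induction n generalizing S with
  | zero =>
    obtain rfl := le_antisymm hρ0 hρ
    calc (S.card : ℝ) ≤ 1 := by exact_mod_cast (Finset.card_le_card hSF).trans hF0.le
      _ ≤ 80 ^ d := one_le_pow₀ (by norm_num)
      _ ≤ A * (F 0).card * δ 0 ^ s := (hstage 0).mass
      _ = _ := by ring
  | succ n ih =>
    rcases le_total ρ (δ n) with h | h
    · exact (hstep n).mass_le u ρ hρ h S hSF hS
    · obtain ⟨T, hTF, hT, hcard⟩ := (hstep n).equidistributed _ S hSF hS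
      have hpos : (0 : ℝ) < (F n).card := Nat.cast_pos.2 (hstage n).nonempty.card_pos
      refine le_of_mul_le_mul_right ?_ hpos
      calc (S.card : ℝ) * (F n).card ≤ T.card * (F (n + 1)).card := by exact_mod_cast hcard
        _ ≤ A * ρ ^ s * (F n).card * (F (n + 1)).card := by
          gcongr
          exact ih h T hTF hT
        _ = _ := by ring

/-- The points of the unit cube that are infinitely often `q ^ (-τ)`-close to a point with odd
denominator `q` and even numerators have positive `s`-dimensional measure for `s < (d + 1) / τ`. -/
theorem hausdorffMeasure_evenApproximable_ne_zero {d : ℕ} {s τ : ℝ} (hd : 1 ≤ d) (hs : 0 < s)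
    (hsd : s < d) (hτs : τ * s < d + 1) (hτ : ((d : ℝ) + 1) / d < τ) :
    μH[s] {x : Fin d → ℝ | (∀ j, x j ∈ Set.Ico (0 : ℝ) 1) ∧
        {q : ℕ | Odd q ∧ ∃ p : Fin d → ℤ, ∀ j, Even (p j) ∧
          |(q : ℝ) * x j - (p j : ℝ)| ≤ (q : ℝ) ^ (1 - τ)}.Infinite} ≠ 0 := by
  have hA : (0 : ℝ) < 80 ^ d * 4 ^ s := by positivity
  have h₀ : IsCantorStage d (80 ^ d * 4 ^ s) s {fun _ => 1 / 2} (1 / 4) := by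
    refine ⟨Finset.singleton_nonempty _, by norm_num, ?_, ?_, ?_⟩
    · simp only [Finset.mem_singleton]
      rintro x rfl j
      norm_num
    · simp only [Finset.mem_singleton]
      rintro x rfl y rfl hxy
      exact absurd rfl hxy
    · rw [Finset.card_singleton, Nat.cast_one, mul_one, mul_assoc,
        ← Real.mul_rpow (by norm_num) (by norm_num)]
      norm_num
  obtain ⟨F, δ, hF0, hδ0, hstage, hstep⟩ := exists_seq_isCantorStep hd hA hs hsd hτs hτ h₀
  have hδle : ∀ n, δ n ≤ 1 / 4 * (1 / 2) ^ n := by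
    intro n
    induction n with
    | zero => simp [hδ0]
    | succ n ih =>
      have := (hstep n).radius_le
      rw [pow_succ]
      linarith
  have hδlim : Filter.Tendsto δ Filter.atTop (nhds 0) := by
    refine squeeze_zero (fun n => (hstage n).pos.le) hδle ?_
    simpa using (tendsto_pow_atTop_nhds_zero_of_lt_one (by norm_num : (0 : ℝ) ≤ 1 / 2)
      (by norm_num)).const_mul (1 / 4 : ℝ)
  have hne := hausdorffMeasure_iInter_ne_zero hs hA F δ (fun n => (hstage n).nonempty)
    (fun n => (hstage n).pos) hδlim (fun n => (hstep n).nested)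
    (fun n u ρ h1 h2 S => IsCantorStep.card_le (by simp [hF0]) hstage hstep n u ρ h1 h2 S)
  refine fun h => hne (measure_mono_null (fun z hz => ?_) h)
  simp only [Set.mem_iInter, Set.mem_iUnion, Metric.mem_closedBall] at hz
  refine ⟨fun j => ?_, Set.infinite_of_forall_exists_gt fun n => ?_⟩
  · obtain ⟨x, hx, hzx⟩ := hz 0
    have h1 := (hstage 0).inside x hx j
    have h2 := (dist_pi_le_iff (hstage 0).pos.le).1 hzx j
    rw [Real.dist_eq, abs_le] at h2
    constructor <;> linarith
  · obtain ⟨y, hy, hzy⟩ := hz (n + 2)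
    obtain ⟨q, hnq, hq, ⟨a, rfl⟩, hδq⟩ := (hstep (n + 1)).approx y hy
    have hq0 : (0 : ℝ) < q := Nat.cast_pos.2 hq.pos
    refine ⟨q, ⟨hq, fun j => 2 * a j, fun j => ⟨even_two_mul _, ?_⟩⟩, hnq⟩
    have h1 := ((dist_pi_le_iff (hstage _).pos.le).1 hzy j).trans hδq
    rw [Real.dist_eq, evenPoint] at h1
    calc |(q : ℝ) * z j - ((2 * a j : ℤ) : ℝ)| = q * |z j - 2 * a j / q| := by
          rw [← abs_of_pos hq0, ← abs_mul, abs_of_pos hq0]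
          congr 1
          push_cast
          field_simp
      _ ≤ q * (q : ℝ) ^ (-τ) := by gcongr
      _ = (q : ℝ) ^ (1 - τ) := by rw [sub_eq_add_neg, Real.rpow_add hq0, Real.rpow_one]

/-- Jarník–Besicovitch-type theorem with parity restrictions: the set of points of the
torus that are `q^{1-τ}`-approximable by rationals `p_j/q` with `q` odd and `p_j` even,
for infinitely many `q`, has Hausdorff dimension `(d+1)/τ`. -/
theorem stmt11 (d : ℕ) (hd : 1 ≤ d) (τ : ℝ) (hτ : ((d : ℝ) + 1) / d < τ) :
    dimH {x : Fin d → ℝ | (∀ j, x j ∈ Set.Ico (0 : ℝ) 1) ∧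
        {q : ℕ | Odd q ∧ ∃ p : Fin d → ℤ, ∀ j, Even (p j) ∧
          |(q : ℝ) * x j - (p j : ℝ)| ≤ (q : ℝ) ^ (1 - τ)}.Infinite} =
      ENNReal.ofReal (((d : ℝ) + 1) / τ) := by
  have hd0 : (0 : ℝ) < d := Nat.cast_pos.2 hd
  have hτ1 : 1 < τ := lt_of_le_of_lt (by rw [le_div_iff₀ hd0]; linarith) hτ
  have hτ0 : 0 < τ := by linarith
  refine le_antisymm (le_trans (dimH_mono ?_) (dimH_wellApproximable_le d hτ1.le)) ?_
  · rintro x ⟨hx, hinf⟩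
    exact ⟨hx, hinf.mono fun q hq => hq.2.imp fun p hp j => (hp j).2⟩
  · refine ENNReal.le_of_forall_nnreal_lt fun s hs => ?_
    rcases eq_zero_or_pos s with rfl | hs0
    · simp
    refine le_dimH_of_hausdorffMeasure_ne_zero ?_
    rw [← ENNReal.ofReal_coe_nnreal, ENNReal.ofReal_lt_ofReal_iff (by positivity)] at hs
    refine hausdorffMeasure_evenApproximable_ne_zero hd (by exact_mod_cast hs0) (hs.trans ?_) ?_ hτ
    · rw [div_lt_iff₀ hd0] at hτ
      rw [div_lt_iff₀ hτ0]
      linarith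
    · rw [lt_div_iff₀ hτ0] at hs
      linarith
end

section
/- Suppose there are integers 1 ≤ a, q ≤ N with gcd(a,q) = 1 such that |t − a/q| ≤ q^{−1}N^{−1}, and let b be an integer with 1 ≤ b ≤ q and |x − b/q| ≤ 1/(2q). Set β₁ = x − b/q, β₂ = t − a/q, S(q) = ∑_{r=0}^{q−1} e^{2πi(br/q + ar²/q)}, and I(β₁,β₂) = ∫₀^N e^{2πi(β₁ξ + β₂ξ²)} dξ. Then |∑_{n=1}^N e^{2πi(xn + tn²)} − q^{−1}S(q)I(β₁,β₂)| ≤ C(q^{1/2} + N|β₂|^{1/2}q^{1/2}) for an absolute constant C. -/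
open Real Finset

namespace WeylSum

/-- The additive character `x ↦ exp (2πix)` of `ℝ`. -/
noncomputable def e (x : ℝ) : ℂ := Complex.exp (2 * Real.pi * Complex.I * (x : ℂ))

theorem e_eq (x : ℝ) : e x = Complex.exp ((2 * π * x : ℝ) * Complex.I) := by
  unfold e
  congr 1
  push_cast
  ring

@[simp] theorem norm_e (x : ℝ) : ‖e x‖ = 1 := by
  rw [e_eq, Complex.norm_exp_ofReal_mul_I]

@[simp] theorem e_zero : e 0 = 1 := by simp [e]

theorem e_add (x y : ℝ) : e (x + y) = e x * e y := by
  unfold e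
  rw [← Complex.exp_add]
  congr 1
  push_cast
  ring

theorem e_int (k : ℤ) : e k = 1 := by
  unfold e
  rw [← Complex.exp_int_mul_two_pi_mul_I k]
  congr 1
  push_cast
  ring

theorem norm_e_sub_one (x : ℝ) : ‖e x - 1‖ = 2 * |sin (π * x)| := by
  rw [e_eq, mul_comm, Complex.norm_exp_I_mul_ofReal_sub_one, norm_mul]
  simp only [Real.norm_eq_abs, abs_two]
  congr 3
  ring

theorem norm_e_sub_e (x y : ℝ) : ‖e x - e y‖ ≤ 2 * π * |x - y| := by
  have h : e x - e y = e y * (e (x - y) - 1) := by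
    rw [mul_sub, ← e_add, mul_one]
    congr 2
    ring
  rw [h, norm_mul, norm_e, one_mul, norm_e_sub_one]
  have h1 : |sin (π * (x - y))| ≤ |π * (x - y)| := Real.abs_sin_le_abs
  rw [abs_mul, abs_of_pos pi_pos] at h1
  linarith

theorem norm_e_sub_one_le (x : ℝ) : ‖e x - 1‖ ≤ 2 * π * |x| := by
  simpa using norm_e_sub_e x 0

theorem four_mul_abs_le_norm_e_sub_one {x : ℝ} (hx : |x| ≤ 1 / 2) : 4 * |x| ≤ ‖e x - 1‖ := by
  rw [norm_e_sub_one]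
  have h := Real.mul_abs_le_abs_sin (x := π * x) (by
    rw [abs_mul, abs_of_pos pi_pos]
    nlinarith [pi_pos])
  rw [abs_mul, abs_of_pos pi_pos] at h
  have : 2 / π * (π * |x|) = 2 * |x| := by field_simp
  linarith

theorem e_sub_int (x : ℝ) (k : ℤ) : e (x - k) = e x := by
  rw [sub_eq_add_neg, e_add]
  have := e_int (-k)
  push_cast at this
  rw [this, mul_one]

theorem four_mul_abs_sub_round_le (x : ℝ) : 4 * |x - round x| ≤ ‖e x - 1‖ := by
  rw [← e_sub_int x (round x)]
  exact four_mul_abs_le_norm_e_sub_one (abs_sub_round x)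

/-- If `|x|` lies between `m` and `1 - m` then `e x` is at distance at least `4 m` from `1`. -/
theorem four_mul_le_norm_e_sub_one {x m : ℝ} (h₁ : m ≤ |x|) (h₂ : |x| ≤ 1 - m) :
    4 * m ≤ ‖e x - 1‖ := by
  refine le_trans ?_ (four_mul_abs_sub_round_le x)
  gcongr
  rcases eq_or_ne (round x) 0 with h | h
  · simpa [h] using h₁
  · have h3 : (1 : ℝ) ≤ |(round x : ℝ)| := by exact_mod_cast Int.one_le_abs h
    have := abs_sub_abs_le_abs_sub (round x : ℝ) x
    rw [abs_sub_comm] at this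
    linarith

theorem norm_sum_mul_sub_le (u v : ℕ → ℂ) (hu : ∀ n, ‖u n‖ ≤ 1) (M : ℕ) :
    ‖∑ n ∈ range M, v n * (u (n + 1) - u n)‖ ≤
      ‖v 0‖ + ‖v M‖ + ∑ n ∈ range M, ‖v (n + 1) - v n‖ := by
  have key : ∑ n ∈ range M, v n * (u (n + 1) - u n) =
      v M * u M - v 0 * u 0 - ∑ n ∈ range M, (v (n + 1) - v n) * u (n + 1) := by
    induction M with
    | zero => simp
    | succ k ih => rw [sum_range_succ, ih, sum_range_succ]; ring
  have hmul : ∀ z n, ‖z * u n‖ ≤ ‖z‖ := fun z n => by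
    rw [norm_mul]; exact mul_le_of_le_one_right (norm_nonneg _) (hu n)
  rw [key]
  calc _ ≤ ‖v M * u M‖ + ‖v 0 * u 0‖ + ‖∑ n ∈ range M, (v (n + 1) - v n) * u (n + 1)‖ :=
        (norm_sub_le _ _).trans (add_le_add_left (norm_sub_le _ _) _)
    _ ≤ ‖v M‖ + ‖v 0‖ + ∑ n ∈ range M, ‖v (n + 1) - v n‖ := by
        gcongr
        · exact hmul _ _
        · exact hmul _ _
        · exact (norm_sum_le _ _).trans (sum_le_sum fun n _ => hmul _ _)
    _ = _ := by ring

/-- A regularised inverse of a complex number. -/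
noncomputable def regInv (ε : ℝ) (w : ℂ) : ℂ := starRingEnd ℂ w / ((‖w‖ ^ 2 + ε : ℝ) : ℂ)

theorem norm_regInv_le {ε : ℝ} {w : ℂ} (hε : 0 ≤ ε) :
    ‖regInv ε w‖ ≤ 1 / √(‖w‖ ^ 2 + ε) := by
  have h0 : 0 ≤ ‖w‖ ^ 2 + ε := by positivity
  have h1 : ‖w‖ ≤ √(‖w‖ ^ 2 + ε) := Real.le_sqrt_of_sq_le (by linarith)
  rw [regInv, norm_div, RCLike.norm_conj, Complex.norm_real, Real.norm_of_nonneg h0]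
  rcases h0.eq_or_lt with h | h
  · simp [← h]
  · have h2 : 0 < √(‖w‖ ^ 2 + ε) := Real.sqrt_pos.2 h
    rw [div_le_div_iff₀ h h2]
    nlinarith [Real.mul_self_sqrt h0]

theorem norm_regInv_sub_le {ε : ℝ} {w z : ℂ} (hε : 0 ≤ ε) (hw : 0 < ‖w‖ ^ 2 + ε)
    (hz : 0 < ‖z‖ ^ 2 + ε) :
    ‖regInv ε z - regInv ε w‖ ≤ ‖z - w‖ / (√(‖w‖ ^ 2 + ε) * √(‖z‖ ^ 2 + ε)) := by
  have hwc : ((‖w‖ ^ 2 + ε : ℝ) : ℂ) ≠ 0 := by exact_mod_cast hw.ne'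
  have hzc : ((‖z‖ ^ 2 + ε : ℝ) : ℂ) ≠ 0 := by exact_mod_cast hz.ne'
  have key : regInv ε z - regInv ε w =
      ((ε : ℂ) * starRingEnd ℂ (z - w) - starRingEnd ℂ w * starRingEnd ℂ z * (z - w)) /
        (((‖w‖ ^ 2 + ε : ℝ) : ℂ) * ((‖z‖ ^ 2 + ε : ℝ) : ℂ)) := by
    unfold regInv
    rw [div_sub_div _ _ hzc hwc, mul_comm ((‖w‖ ^ 2 + ε : ℝ) : ℂ)]
    congr 1
    push_cast
    rw [← Complex.mul_conj', ← Complex.mul_conj', map_sub]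
    ring
  set P := √(‖w‖ ^ 2 + ε) with hP
  set Q := √(‖z‖ ^ 2 + ε) with hQ
  have hP0 : 0 < P := Real.sqrt_pos.2 hw
  have hQ0 : 0 < Q := Real.sqrt_pos.2 hz
  have hP2 : ‖w‖ ^ 2 + ε = P ^ 2 := (Real.sq_sqrt hw.le).symm
  have hQ2 : ‖z‖ ^ 2 + ε = Q ^ 2 := (Real.sq_sqrt hz.le).symm
  have hcs : ε + ‖w‖ * ‖z‖ ≤ P * Q := by
    rw [hP, hQ, ← Real.sqrt_mul hw.le]
    apply Real.le_sqrt_of_sq_le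
    nlinarith [mul_nonneg hε (sq_nonneg (‖w‖ - ‖z‖))]
  rw [key, norm_div, norm_mul, Complex.norm_real, Complex.norm_real, Real.norm_of_nonneg hw.le,
    Real.norm_of_nonneg hz.le, hP2, hQ2]
  have hnum : ‖(ε : ℂ) * starRingEnd ℂ (z - w) - starRingEnd ℂ w * starRingEnd ℂ z * (z - w)‖ ≤
      ‖z - w‖ * (P * Q) := by
    refine (norm_sub_le _ _).trans ?_
    rw [norm_mul, norm_mul, norm_mul, RCLike.norm_conj, RCLike.norm_conj, RCLike.norm_conj,
      Complex.norm_real, Real.norm_of_nonneg hε]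
    nlinarith [norm_nonneg (z - w)]
  rw [div_le_div_iff₀ (by positivity) (by positivity)]
  calc _ ≤ ‖z - w‖ * (P * Q) * (P * Q) := by gcongr
    _ = _ := by ring

theorem one_sub_mul_regInv {ε : ℝ} {w : ℂ} (hw : 0 < ‖w‖ ^ 2 + ε) :
    1 - w * regInv ε w = ((ε / (‖w‖ ^ 2 + ε) : ℝ) : ℂ) := by
  have hwc : ((‖w‖ ^ 2 + ε : ℝ) : ℂ) ≠ 0 := by exact_mod_cast hw.ne'
  unfold regInv
  rw [Complex.ofReal_div, eq_div_iff hwc, sub_mul, mul_assoc, div_mul_cancel₀ _ hwc,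
    Complex.mul_conj']
  push_cast
  ring

/-- Summation by parts against a sequence `u` with multiplicative increments `1 + w`. -/
theorem norm_sum_mul_le (u w y : ℕ → ℂ) (hu : ∀ n, ‖u n‖ ≤ 1)
    (huw : ∀ n, u (n + 1) = u n * (1 + w n)) {ε : ℝ} (hε : 0 ≤ ε) (M : ℕ)
    (hw : ∀ n ≤ M, 0 < ‖w n‖ ^ 2 + ε) :
    ‖∑ n ∈ range M, u n * y n‖ ≤
      ‖y 0‖ / √(‖w 0‖ ^ 2 + ε) + ‖y M‖ / √(‖w M‖ ^ 2 + ε) +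
      ∑ n ∈ range M, (‖y (n + 1) - y n‖ / √(‖w (n + 1)‖ ^ 2 + ε) +
        ‖y n‖ * (‖w (n + 1) - w n‖ / (√(‖w n‖ ^ 2 + ε) * √(‖w (n + 1)‖ ^ 2 + ε))) +
        ‖y n‖ * (ε / (‖w n‖ ^ 2 + ε))) := by
  set v : ℕ → ℂ := fun n => y n * regInv ε (w n) with hv
  have hvn : ∀ n, ‖v n‖ ≤ ‖y n‖ / √(‖w n‖ ^ 2 + ε) := fun n => by
    rw [hv, norm_mul, div_eq_mul_one_div]
    gcongr
    exact norm_regInv_le hε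
  have key : ∑ n ∈ range M, u n * y n = ∑ n ∈ range M, v n * (u (n + 1) - u n) +
      ∑ n ∈ range M, u n * y n * ((ε / (‖w n‖ ^ 2 + ε) : ℝ) : ℂ) := by
    rw [← sum_add_distrib]
    refine sum_congr rfl fun n hn => ?_
    rw [← one_sub_mul_regInv (hw n (mem_range.1 hn).le), huw n]
    ring
  rw [key]
  have h1 := norm_sum_mul_sub_le u v hu M
  have h2 : ‖∑ n ∈ range M, u n * y n * ((ε / (‖w n‖ ^ 2 + ε) : ℝ) : ℂ)‖ ≤
      ∑ n ∈ range M, ‖y n‖ * (ε / (‖w n‖ ^ 2 + ε)) := by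
    refine (norm_sum_le _ _).trans (sum_le_sum fun n hn => ?_)
    have := hw n (mem_range.1 hn).le
    rw [norm_mul, norm_mul, Complex.norm_real, Real.norm_of_nonneg (by positivity)]
    gcongr
    exact mul_le_of_le_one_left (norm_nonneg _) (hu n)
  have h3 : ∀ n ∈ range M, ‖v (n + 1) - v n‖ ≤ ‖y (n + 1) - y n‖ / √(‖w (n + 1)‖ ^ 2 + ε) +
      ‖y n‖ * (‖w (n + 1) - w n‖ / (√(‖w n‖ ^ 2 + ε) * √(‖w (n + 1)‖ ^ 2 + ε))) := by
    intro n hn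
    have hn := mem_range.1 hn
    have : v (n + 1) - v n = (y (n + 1) - y n) * regInv ε (w (n + 1)) +
        y n * (regInv ε (w (n + 1)) - regInv ε (w n)) := by simp only [hv]; ring
    rw [this]
    refine (norm_add_le _ _).trans ?_
    rw [norm_mul, norm_mul, div_eq_mul_one_div ‖y (n + 1) - y n‖]
    gcongr
    · exact norm_regInv_le hε
    · exact norm_regInv_sub_le hε (hw n hn.le) (hw _ hn)
  have h4 := sum_le_sum h3
  refine (norm_add_le _ _).trans ?_
  rw [sum_add_distrib (f := fun n => _ + _)]
  linarith [hvn 0, hvn M]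

/-- The version of `norm_sum_mul_le` without regularisation. -/
theorem norm_sum_mul_le_of_le (u w y : ℕ → ℂ) (hu : ∀ n, ‖u n‖ ≤ 1)
    (huw : ∀ n, u (n + 1) = u n * (1 + w n)) (M : ℕ) {μ Y Y' d : ℝ} (hμ : 0 < μ)
    (hw : ∀ n ≤ M, μ ≤ ‖w n‖) (hy : ∀ n ≤ M, ‖y n‖ ≤ Y)
    (hy' : ∀ n, ‖y (n + 1) - y n‖ ≤ Y') (hw' : ∀ n, ‖w (n + 1) - w n‖ ≤ d) :
    ‖∑ n ∈ range M, u n * y n‖ ≤ 2 * (Y / μ) + M * (Y' / μ + Y * (d / (μ * μ))) := by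
  have hY : 0 ≤ Y := (norm_nonneg _).trans (hy 0 (Nat.zero_le _))
  have hpos : ∀ n ≤ M, 0 < ‖w n‖ := fun n hn => hμ.trans_le (hw n hn)
  have h := norm_sum_mul_le u w y hu huw le_rfl M (fun n hn => by have := hpos n hn; positivity)
  simp only [add_zero, Real.sqrt_sq (norm_nonneg _), zero_div, mul_zero] at h
  have h1 : ∀ n ≤ M, ‖y n‖ / ‖w n‖ ≤ Y / μ := fun n hn => by
    gcongr
    exacts [hy n hn, hw n hn]
  have h2 := sum_le_card_nsmul (range M) (fun n => ‖y (n + 1) - y n‖ / ‖w (n + 1)‖ +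
    ‖y n‖ * (‖w (n + 1) - w n‖ / (‖w n‖ * ‖w (n + 1)‖))) (Y' / μ + Y * (d / (μ * μ)))
    (fun n hn => by
      have hn := mem_range.1 hn
      have e1 := hw n hn.le
      have e2 := hw (n + 1) hn
      have hY' : 0 ≤ Y' := (norm_nonneg _).trans (hy' 0)
      have hd : 0 ≤ d := (norm_nonneg _).trans (hw' 0)
      gcongr
      exacts [hy' n, hy n hn.le, hw' n])
  rw [card_range, nsmul_eq_mul] at h2
  linarith [h1 0 (Nat.zero_le _), h1 M le_rfl]

theorem div_one_add_sq_le_arctan_sub {s : ℝ} (hs : 0 < s) (x : ℝ) :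
    s / (1 + x ^ 2) ≤ 2 * (1 + s ^ 2) * (arctan (x + s) - arctan x) := by
  obtain ⟨ξ, ⟨h1, h2⟩, h3⟩ := exists_deriv_eq_slope arctan (show x < x + s by linarith)
    Real.continuous_arctan.continuousOn Real.differentiable_arctan.differentiableOn
  rw [Real.deriv_arctan, add_sub_cancel_left, eq_div_iff hs.ne'] at h3
  rw [← h3, one_div_mul_eq_div, ← mul_div_assoc, div_le_div_iff₀ (by positivity) (by positivity)]
  have : 1 + ξ ^ 2 ≤ 2 * (1 + s ^ 2) * (1 + x ^ 2) := by
    have h4 : (ξ - x) ^ 2 ≤ s ^ 2 := by nlinarith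
    nlinarith [sq_nonneg (ξ - 2 * x), mul_nonneg (sq_nonneg s) (sq_nonneg x)]
  nlinarith

theorem abs_arctan_sub_arctan_le_pi (x y : ℝ) : |arctan x - arctan y| ≤ π := by
  have := Real.arctan_lt_pi_div_two x
  have := Real.neg_pi_div_two_lt_arctan x
  have := Real.arctan_lt_pi_div_two y
  have := Real.neg_pi_div_two_lt_arctan y
  rw [abs_le]
  constructor <;> linarith

theorem sum_one_div_one_add_sq_le {s : ℝ} (hs : s ≠ 0) (c : ℝ) (M : ℕ) :
    ∑ n ∈ range M, 1 / (1 + (c + s * n) ^ 2) ≤ 2 * π * (1 + s ^ 2) / |s| := by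
  wlog hpos : 0 < s generalizing s c
  · have := this (neg_ne_zero.2 hs) (-c) (by
      rcases lt_or_gt_of_ne hs with h | h
      · linarith
      · exact absurd h hpos)
    rw [abs_neg, neg_sq] at this
    refine le_trans (le_of_eq ?_) this
    refine sum_congr rfl fun n _ => ?_
    congr 2
    ring
  rw [abs_of_pos hpos, le_div_iff₀ hpos, sum_mul]
  calc _ ≤ ∑ n ∈ range M, 2 * (1 + s ^ 2) *
        (arctan (c + s * (n + 1 : ℕ)) - arctan (c + s * n)) := by
        refine sum_le_sum fun n _ => ?_
        have := div_one_add_sq_le_arctan_sub hpos (c + s * n)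
        have hstep : c + s * ((n + 1 : ℕ) : ℝ) = c + s * n + s := by push_cast; ring
        rwa [one_div_mul_eq_div, hstep]
    _ = 2 * (1 + s ^ 2) * (arctan (c + s * M) - arctan (c + s * (0 : ℕ))) := by
        rw [← mul_sum, sum_range_sub (fun n : ℕ => arctan (c + s * n))]
    _ ≤ 2 * (1 + s ^ 2) * π := by
        gcongr
        exact (le_abs_self _).trans (abs_arctan_sub_arctan_le_pi _ _)
    _ = _ := by ring

/-- The multiplicative increment of the quadratic phase `e (α n + β n ^ 2)`, minus `1`. -/
noncomputable def incr (α β : ℝ) (n : ℕ) : ℂ := e (α + β * (2 * n + 1)) - 1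

theorem e_quadratic_succ (α β : ℝ) (n : ℕ) :
    e (α * (n + 1 : ℕ) + β * ((n + 1 : ℕ) : ℝ) ^ 2) =
      e (α * n + β * (n : ℝ) ^ 2) * (1 + incr α β n) := by
  rw [incr, add_sub_cancel, ← e_add]
  congr 1
  push_cast
  ring

theorem norm_incr_succ_sub_le (α β : ℝ) (n : ℕ) :
    ‖incr α β (n + 1) - incr α β n‖ ≤ 4 * π * |β| := by
  rw [incr, incr, sub_sub_sub_cancel_right]
  refine (norm_e_sub_e _ _).trans (le_of_eq ?_)
  have : α + β * (2 * ((n + 1 : ℕ) : ℝ) + 1) - (α + β * (2 * n + 1)) = 2 * β := by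
    push_cast; ring
  rw [this, abs_mul, abs_two]
  ring

/-- The second derivative test for sums of quadratic phases with bounded derivative. -/
theorem exists_norm_sum_quadratic_le : ∃ C > 0, ∀ (M : ℕ) (α β : ℝ), β ≠ 0 → |α| ≤ 1 →
    M * |β| ≤ 64 → ‖∑ n ∈ range M, e (α * n + β * (n : ℝ) ^ 2)‖ ≤ C / √|β| := by
  refine ⟨2 + (8 * π + 1) * (401 * (π * 257)), by positivity, fun M α β hβ hα hM => ?_⟩
  rcases Nat.eq_zero_or_pos M with rfl | hM0
  · simp only [range_zero, sum_empty, norm_zero]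
    positivity
  have hM1 : (1 : ℝ) ≤ M := by exact_mod_cast hM0
  set ε := |β| with hε
  have hε0 : 0 < ε := abs_pos.2 hβ
  have hε64 : ε ≤ 64 := by nlinarith
  set w := incr α β with hw
  set p : ℕ → ℝ := fun n => ‖w n‖ ^ 2 + ε with hp
  have hp0 : ∀ n, 0 < p n := fun n => by simp only [hp]; positivity
  have hsum : ∑ n ∈ range (M + 1), ε / p n ≤ 401 * (π * 257) / √ε := by
    have h1 : ∀ n ∈ range (M + 1), ε / p n ≤ ∑ k ∈ Icc (-200 : ℤ) 200,
        1 / (1 + ((α + β - k) / √ε + 2 * β / √ε * n) ^ 2) := by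
      intro n hn
      have hn : (n : ℝ) ≤ M := by exact_mod_cast Nat.lt_succ_iff.1 (mem_range.1 hn)
      set δ := α + β * (2 * n + 1) with hδ
      have hδ' : |δ| ≤ 193 := by
        refine (abs_add_le _ _).trans ?_
        rw [abs_mul, abs_of_nonneg (show (0 : ℝ) ≤ 2 * n + 1 by positivity), ← hε]
        nlinarith
      have hr : round δ ∈ Icc (-200 : ℤ) 200 := by
        have h1 := abs_sub_round δ
        rw [abs_le] at h1 hδ'
        rw [mem_Icc]
        constructor
        · have : (-200 : ℝ) ≤ round δ := by linarith
          exact_mod_cast this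
        · have : (round δ : ℝ) ≤ 200 := by linarith
          exact_mod_cast this
      refine le_trans ?_ (single_le_sum (fun k _ => by positivity) hr)
      have h2 : (α + β - round δ) / √ε + 2 * β / √ε * n = (δ - round δ) / √ε := by
        rw [hδ]; ring
      rw [h2, div_pow, Real.sq_sqrt hε0.le, div_le_div_iff₀ (hp0 n) (by positivity)]
      have h3 := four_mul_abs_sub_round_le δ
      have h4 : (δ - round δ) ^ 2 ≤ ‖w n‖ ^ 2 := by
        rw [← sq_abs (δ - round δ)]
        exact pow_le_pow_left₀ (abs_nonneg _)
          (by simp only [hw, incr]; linarith [abs_nonneg (δ - round δ)]) 2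
      have h5 : ε * (1 + (δ - round δ) ^ 2 / ε) = ε + (δ - round δ) ^ 2 := by field_simp
      rw [h5]
      simp only [hp]
      linarith
    refine (sum_le_sum h1).trans ?_
    rw [sum_comm]
    have hs : 2 * β / √ε ≠ 0 := by positivity
    have habs : |2 * β / √ε| = 2 * √ε := by
      rw [abs_div, abs_mul, abs_two, ← hε, abs_of_nonneg (Real.sqrt_nonneg _), mul_div_assoc,
        Real.div_sqrt]
    have h2 : ∀ k ∈ Icc (-200 : ℤ) 200, ∑ n ∈ range (M + 1),
        1 / (1 + ((α + β - k) / √ε + 2 * β / √ε * n) ^ 2) ≤ π * 257 / √ε := by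
      intro k _
      refine (sum_one_div_one_add_sq_le hs _ _).trans ?_
      rw [← sq_abs (2 * β / √ε), habs, mul_pow, Real.sq_sqrt hε0.le,
        div_le_div_iff₀ (by positivity) (by positivity)]
      have h5 : 0 ≤ π * √ε := by positivity
      nlinarith
    refine (sum_le_card_nsmul _ _ _ h2).trans (le_of_eq ?_)
    have hcard : #(Icc (-200 : ℤ) 200) = 401 := by simp
    rw [nsmul_eq_mul, hcard]
    push_cast
    ring
  have h := norm_sum_mul_le (fun n => e (α * n + β * (n : ℝ) ^ 2)) w (fun _ => 1)
    (fun n => (norm_e _).le) (e_quadratic_succ α β) hε0.le M (fun n _ => hp0 n)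
  simp only [mul_one, norm_one, sub_self, norm_zero, zero_div, zero_add, one_mul] at h
  refine h.trans ?_
  have h0 : ∀ n, 1 / √(p n) ≤ 1 / √ε := fun n => by
    gcongr
    simp only [hp]
    nlinarith [sq_nonneg ‖w n‖]
  have h1 : ∀ n ∈ range M, ‖w (n + 1) - w n‖ / (√(p n) * √(p (n + 1))) + ε / p n ≤
      (4 * π + 1) * (ε / p n) + 4 * π * (ε / p (n + 1)) := by
    intro n _
    have e1 : 1 / (√(p n) * √(p (n + 1))) ≤ 1 / p n + 1 / p (n + 1) := by
      have a1 := Real.sq_sqrt (hp0 n).le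
      have a2 := Real.sq_sqrt (hp0 (n + 1)).le
      have b1 := Real.sqrt_pos.2 (hp0 n)
      have b2 := Real.sqrt_pos.2 (hp0 (n + 1))
      set A := √(p n)
      set B := √(p (n + 1))
      rw [← a1, ← a2, div_add_div _ _ (by positivity) (by positivity),
        div_le_div_iff₀ (by positivity) (by positivity)]
      have : 0 < A * B := by positivity
      nlinarith [sq_nonneg (A - B)]
    have e2 : ‖w (n + 1) - w n‖ / (√(p n) * √(p (n + 1))) ≤
        4 * π * ε * (1 / p n + 1 / p (n + 1)) := by
      rw [div_eq_mul_one_div]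
      gcongr
      exact norm_incr_succ_sub_le α β n
    calc _ ≤ 4 * π * ε * (1 / p n + 1 / p (n + 1)) + ε / p n := by gcongr
      _ = _ := by ring
  have h2 : ∑ n ∈ range M, (‖w (n + 1) - w n‖ / (√(p n) * √(p (n + 1))) + ε / p n) ≤
      (4 * π + 1) * ∑ n ∈ range M, ε / p n + 4 * π * ∑ n ∈ range M, ε / p (n + 1) := by
    rw [mul_sum, mul_sum, ← sum_add_distrib]
    exact sum_le_sum h1
  have h3 : ∑ n ∈ range M, ε / p n ≤ ∑ n ∈ range (M + 1), ε / p n := by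
    rw [sum_range_succ]
    have := hp0 M
    linarith [show 0 ≤ ε / p M by positivity]
  have h4 : ∑ n ∈ range M, ε / p (n + 1) ≤ ∑ n ∈ range (M + 1), ε / p n := by
    rw [sum_range_succ']
    have := hp0 0
    linarith [show 0 ≤ ε / p 0 by positivity]
  have h5 : (2 + (8 * π + 1) * (401 * (π * 257))) / √ε =
    1 / √ε + 1 / √ε + (8 * π + 1) * (401 * (π * 257) / √ε) := by ring
  rw [h5]
  have hpi := pi_pos
  set X := ∑ n ∈ range (M + 1), ε / p n
  calc _ ≤ 1 / √ε + 1 / √ε + ((4 * π + 1) * X + 4 * π * X) := by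
        refine add_le_add (add_le_add (h0 0) (h0 M)) (h2.trans ?_)
        gcongr
    _ = 1 / √ε + 1 / √ε + (8 * π + 1) * X := by ring
    _ ≤ _ := by gcongr

theorem hasDerivAt_e_quadratic (α β u : ℝ) :
    HasDerivAt (fun u : ℝ => e (α * u + β * u ^ 2))
      (2 * π * Complex.I * ((α + 2 * β * u : ℝ) : ℂ) * e (α * u + β * u ^ 2)) u := by
  have h1 : HasDerivAt (fun u : ℝ => α * u + β * u ^ 2) (α + 2 * β * u) u := by
    exact (((hasDerivAt_id' u).const_mul α).add
      ((hasDerivAt_pow 2 u).const_mul β)).congr_deriv (by simp; ring)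
  have h2 := (h1.ofReal_comp.const_mul (2 * π * Complex.I)).cexp
  unfold e
  convert h2 using 1
  ring

theorem continuous_e_quadratic (α β : ℝ) : Continuous fun u : ℝ => e (α * u + β * u ^ 2) := by
  unfold e
  fun_prop

/-- The second derivative test for integrals of quadratic phases. -/
theorem norm_integral_quadratic_le {β : ℝ} (hβ : β ≠ 0) (α : ℝ) {N : ℝ} (hN : 0 ≤ N) :
    ‖∫ u in (0 : ℝ)..N, e (α * u + β * u ^ 2)‖ ≤ 10 / √|β| := by
  set ε := |β| with hε
  have hε0 : 0 < ε := abs_pos.2 hβ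
  have hs0 : 0 < √ε := Real.sqrt_pos.2 hε0
  set p : ℝ → ℝ := fun u => α + 2 * β * u with hp
  set g : ℝ → ℂ := fun u => e (α * u + β * u ^ 2) with hg
  set r : ℝ → ℝ := fun u => p u / (p u ^ 2 + ε) with hr
  set r' : ℝ → ℝ := fun u => 2 * β * (ε - p u ^ 2) / (p u ^ 2 + ε) ^ 2 with hr'
  have hden : ∀ u, 0 < p u ^ 2 + ε := fun u => by positivity
  have hpd : ∀ u, HasDerivAt p (2 * β) u := fun u => by
    exact (((hasDerivAt_id' u).const_mul (2 * β)).const_add α).congr_deriv (mul_one _)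
  have hrd : ∀ u, HasDerivAt r (r' u) u := fun u => by
    refine ((hpd u).div (((hpd u).pow 2).add_const ε) (hden u).ne').congr_deriv ?_
    simp only [hr']
    congr 1
    simp
    ring
  have hpc : Continuous p := by fun_prop
  have hgc : Continuous g := continuous_e_quadratic α β
  have hrc : Continuous r := hpc.div (by fun_prop) fun u => (hden u).ne'
  have hrc' : Continuous r' := Continuous.div (by fun_prop) (by fun_prop)
    fun u => pow_ne_zero 2 (hden u).ne'
  set F' : ℝ → ℂ := fun u => (r' u : ℂ) * g u + (r u : ℂ) *
    (2 * π * Complex.I * (p u : ℂ) * g u) with hF'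
  have hFd : ∀ u, HasDerivAt (fun u => (r u : ℂ) * g u) (F' u) u := fun u =>
    (hrd u).ofReal_comp.mul (hasDerivAt_e_quadratic α β u)
  have hF'c : Continuous F' := by
    simp only [hF']
    fun_prop
  have hFI : ∫ u in (0 : ℝ)..N, F' u = (r N : ℂ) * g N - (r 0 : ℂ) * g 0 :=
    intervalIntegral.integral_eq_sub_of_hasDerivAt (fun u _ => hFd u)
      (hF'c.intervalIntegrable _ _)
  have hrb : ∀ u, ‖(r u : ℂ) * g u‖ ≤ 1 / √ε := fun u => by
    rw [norm_mul, hg, norm_e, mul_one, Complex.norm_real, Real.norm_eq_abs, hr, abs_div,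
      abs_of_pos (hden u), div_le_div_iff₀ (hden u) hs0, ← sq_abs (p u)]
    nlinarith [Real.sq_sqrt hε0.le, sq_nonneg (|p u| - √ε), sq_nonneg (|p u|)]
  set a' : ℝ → ℝ := fun u => 2 * β / √ε / (1 + (p u / √ε) ^ 2) with ha'
  have had : ∀ u, HasDerivAt (fun u => arctan (p u / √ε)) (a' u) u := fun u => by
    convert ((hpd u).div_const √ε).arctan using 1
    simp only [ha']
    ring
  have hac : Continuous a' := Continuous.div (by fun_prop) (by fun_prop)
    fun u => by positivity
  have haI : ∫ u in (0 : ℝ)..N, a' u = arctan (p N / √ε) - arctan (p 0 / √ε) :=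
    intervalIntegral.integral_eq_sub_of_hasDerivAt (fun u _ => had u)
      (hac.intervalIntegrable _ _)
  set k := √ε / (2 * β) with hk
  have hka : ∀ u, k * a' u = ε / (p u ^ 2 + ε) := fun u => by
    simp only [hk, ha', div_pow, Real.sq_sqrt hε0.le]
    have := (hden u).ne'
    field_simp
    ring
  have hbound : ∀ u, ‖2 * π * Complex.I * g u - F' u‖ ≤ (2 * π + 2) * (k * a' u) := fun u => by
    have e1 : 2 * π * Complex.I * g u - F' u =
        (2 * π * Complex.I * ((ε / (p u ^ 2 + ε) : ℝ) : ℂ) - (r' u : ℂ)) * g u := by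
      have : ((ε / (p u ^ 2 + ε) : ℝ) : ℂ) = 1 - (r u : ℂ) * (p u : ℂ) := by
        rw [← Complex.ofReal_mul, ← Complex.ofReal_one, ← Complex.ofReal_sub]
        congr 1
        have := (hden u).ne'
        simp only [hr]
        field_simp
        ring
      rw [this]
      simp only [hF']
      ring
    have e2 : |r' u| ≤ 2 * (ε / (p u ^ 2 + ε)) := by
      simp only [hr']
      rw [abs_div, abs_mul, abs_mul, abs_two, ← hε, abs_of_pos (pow_pos (hden u) 2),
        ← mul_div_assoc, div_le_div_iff₀ (pow_pos (hden u) 2) (hden u)]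
      have : |ε - p u ^ 2| ≤ p u ^ 2 + ε := by
        rw [abs_le]; constructor <;> nlinarith [sq_nonneg (p u)]
      have h0 := hden u
      calc _ ≤ 2 * ε * (p u ^ 2 + ε) * (p u ^ 2 + ε) := by gcongr
        _ = _ := by ring
    rw [e1, norm_mul, hg, norm_e, mul_one, hka]
    refine (norm_sub_le _ _).trans ?_
    have h0 := hden u
    rw [norm_mul, Complex.norm_real, Complex.norm_real,
      Real.norm_of_nonneg (show 0 ≤ ε / (p u ^ 2 + ε) by positivity), Real.norm_eq_abs]
    have : ‖2 * π * Complex.I‖ = 2 * π := by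
      simp [abs_of_pos pi_pos]
    rw [this]
    linarith
  have hmain : ‖∫ u in (0 : ℝ)..N, (2 * π * Complex.I * g u - F' u)‖ ≤
      ∫ u in (0 : ℝ)..N, (2 * π + 2) * (k * a' u) :=
    intervalIntegral.norm_integral_le_of_norm_le hN
      (Filter.Eventually.of_forall fun u _ => hbound u)
      (Continuous.intervalIntegrable (by fun_prop) _ _)
  rw [intervalIntegral.integral_sub (Continuous.intervalIntegrable (by fun_prop) _ _)
    (hF'c.intervalIntegrable _ _), hFI, intervalIntegral.integral_const_mul,
    intervalIntegral.integral_const_mul, intervalIntegral.integral_const_mul, haI] at hmain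
  have hkb : k * (arctan (p N / √ε) - arctan (p 0 / √ε)) ≤ π / 2 * (1 / √ε) := by
    refine (le_abs_self _).trans ?_
    rw [abs_mul]
    have e1 : |k| = 1 / 2 * (1 / √ε) := by
      rw [hk, abs_div, abs_mul, abs_two, ← hε, abs_of_pos hs0]
      rw [div_eq_iff (by positivity)]
      field_simp
      rw [Real.sq_sqrt hε0.le]
    have e2 : |arctan (p N / √ε) - arctan (p 0 / √ε)| ≤ π := abs_arctan_sub_arctan_le_pi _ _
    rw [e1]
    have : 0 < 1 / √ε := by positivity
    nlinarith
  set J := ∫ u in (0 : ℝ)..N, g u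
  have h3 : ‖2 * π * Complex.I * J‖ ≤ (2 * π + 2) * (π / 2 * (1 / √ε)) + 2 * (1 / √ε) := by
    have e1 : 2 * π * Complex.I * J =
        (2 * π * Complex.I * J - ((r N : ℂ) * g N - (r 0 : ℂ) * g 0)) +
      ((r N : ℂ) * g N - (r 0 : ℂ) * g 0) := by ring
    rw [e1]
    refine (norm_add_le _ _).trans (add_le_add (hmain.trans ?_) ?_)
    · gcongr
    · refine (norm_sub_le _ _).trans ?_
      linarith [hrb N, hrb 0]
  have h4 : ‖2 * π * Complex.I * J‖ = 2 * π * ‖J‖ := by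
    simp [abs_of_pos pi_pos]
  rw [h4] at h3
  have h5 : 10 / √ε = 10 * (1 / √ε) := by ring
  rw [h5]
  set X := 1 / √ε
  have hX : 0 < X := by positivity
  have h6 : 2 * π * ‖J‖ ≤ 2 * π * (10 * X) := by
    refine h3.trans ?_
    have := pi_gt_three
    have := pi_lt_four
    have : (2 * π + 2) * (π / 2) + 2 ≤ 20 * π := by nlinarith
    nlinarith
  exact le_of_mul_le_mul_left h6 (by positivity)

theorem integral_quadratic_eq_sum (α β : ℝ) (N : ℕ) :
    ∫ u in (0 : ℝ)..N, e (α * u + β * u ^ 2) = ∑ n ∈ range N, e (α * n + β * (n : ℝ) ^ 2) *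
      ∫ s in (0 : ℝ)..1, e ((α + 2 * β * n) * s + β * s ^ 2) := by
  have h := intervalIntegral.sum_integral_adjacent_intervals (μ := MeasureTheory.volume)
    (f := fun u : ℝ => e (α * u + β * u ^ 2)) (a := fun n : ℕ => (n : ℝ)) (n := N)
    (fun k _ => (continuous_e_quadratic α β).intervalIntegrable _ _)
  simp only [Nat.cast_zero] at h
  rw [← h]
  refine sum_congr rfl fun n _ => ?_
  rw [← intervalIntegral.integral_const_mul]
  have h2 := intervalIntegral.integral_comp_add_left (a := 0) (b := 1)
    (fun u : ℝ => e (α * u + β * u ^ 2)) (n : ℝ)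
  simp only [add_zero] at h2
  rw [Nat.cast_succ, ← h2]
  refine intervalIntegral.integral_congr fun s _ => ?_
  rw [← e_add]
  congr 1
  ring

/-- A sum of a quadratic phase whose increments stay away from the nonzero integers is close to the
corresponding integral. -/
theorem exists_norm_sum_sub_integral_le : ∃ C > 0, ∀ (N : ℕ) (α β : ℝ), |β| ≤ 1 →
    (∀ n ≤ N, |α + β * (2 * (n : ℝ) + 1)| ≤ 3 / 4) →
    ‖∑ n ∈ range N, e (α * n + β * (n : ℝ) ^ 2) -
      ∫ u in (0 : ℝ)..N, e (α * u + β * u ^ 2)‖ ≤ C * (1 + N * √|β|) := by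
  refine ⟨8 * π + (8 * π + 16 * π ^ 2), by positivity, fun N α β hβ hδ => ?_⟩
  rcases Nat.eq_zero_or_pos N with rfl | hN
  · simp
    positivity
  have hN0 : (0 : ℝ) < N := by exact_mod_cast hN
  set ε := |β| + 1 / (N : ℝ) ^ 2 with hε
  have hε0 : 0 < ε := by positivity
  have hβε : |β| ≤ ε := by rw [hε]; linarith [show 0 < 1 / (N : ℝ) ^ 2 by positivity]
  set w := incr α β with hw
  set W : ℕ → ℂ := fun n => ∫ s in (0 : ℝ)..1, e ((α + 2 * β * n) * s + β * s ^ 2) with hW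
  set y : ℕ → ℂ := fun n => 1 - W n with hy
  set p : ℕ → ℝ := fun n => √(‖w n‖ ^ 2 + ε) with hp
  have hp0 : ∀ n, 0 < p n := fun n => Real.sqrt_pos.2 (by positivity)
  have hpsq : ∀ n, ‖w n‖ ^ 2 + ε = p n ^ 2 := fun n => (Real.sq_sqrt (by positivity)).symm
  have hεp : ∀ n, √ε ≤ p n := fun n => Real.sqrt_le_sqrt (by nlinarith [sq_nonneg ‖w n‖])
  have hwp : ∀ n, ‖w n‖ ≤ p n := fun n => Real.le_sqrt_of_sq_le (by linarith)
  have hβs : |β| ≤ √ε := by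
    apply Real.le_sqrt_of_sq_le
    nlinarith [abs_nonneg β]
  have hint : ∀ a b : ℝ, IntervalIntegrable (fun s : ℝ => e (a * s + b * s ^ 2))
      MeasureTheory.volume 0 1 := fun a b => (continuous_e_quadratic a b).intervalIntegrable _ _
  have hyn : ∀ n ≤ N, ‖y n‖ ≤ 4 * π * p n := by
    intro n hn
    have hδn := hδ n hn
    have e1 : y n = ∫ s in (0 : ℝ)..1, (1 - e ((α + 2 * β * n) * s + β * s ^ 2)) := by
      rw [intervalIntegral.integral_sub (by simp) (hint _ _)]
      simp [hy, hW]
    set δ := α + β * (2 * (n : ℝ) + 1) with hδd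
    have e2 : ‖y n‖ ≤ 2 * π * (|δ| + |β|) * |(1 : ℝ) - 0| := by
      rw [e1]
      refine intervalIntegral.norm_integral_le_of_norm_le_const fun s hs => ?_
      rw [Set.uIoc_of_le zero_le_one] at hs
      rw [norm_sub_rev]
      refine (norm_e_sub_one_le _).trans ?_
      gcongr
      have e3 : (α + 2 * β * n) * s + β * s ^ 2 = s * (δ + -(β * (1 - s))) := by rw [hδd]; ring
      rw [e3, abs_mul, abs_of_pos hs.1]
      calc s * |δ + -(β * (1 - s))| ≤ 1 * (|δ| + |-(β * (1 - s))|) := by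
            gcongr
            · exact hs.2
            · exact abs_add_le _ _
        _ ≤ |δ| + |β| := by
            rw [one_mul, abs_neg, abs_mul, abs_of_nonneg (sub_nonneg.2 hs.2)]
            nlinarith [abs_nonneg β, hs.1]
    have e4 : |δ| ≤ p n := by
      have := four_mul_le_norm_e_sub_one (x := δ) (m := |δ| / 3) (by linarith [abs_nonneg δ])
        (by linarith)
      have h2 : ‖w n‖ = ‖e δ - 1‖ := rfl
      linarith [hwp n, abs_nonneg δ]
    have e5 : |β| ≤ p n := hβs.trans (hεp n)
    rw [sub_zero, abs_one, mul_one] at e2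
    refine e2.trans ?_
    nlinarith [pi_pos]
  have hyd : ∀ n, ‖y (n + 1) - y n‖ ≤ 4 * π * |β| := by
    intro n
    have e1 : y (n + 1) - y n = ∫ s in (0 : ℝ)..1, (e ((α + 2 * β * n) * s + β * s ^ 2) -
        e ((α + 2 * β * (n + 1 : ℕ)) * s + β * s ^ 2)) := by
      rw [intervalIntegral.integral_sub (hint _ _) (hint _ _)]
      simp only [hy, hW]
      ring
    rw [e1]
    refine (intervalIntegral.norm_integral_le_of_norm_le_const (C := 4 * π * |β|)
      fun s hs => ?_).trans (by simp)
    rw [Set.uIoc_of_le zero_le_one] at hs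
    refine (norm_e_sub_e _ _).trans ?_
    have e3 : (α + 2 * β * n) * s + β * s ^ 2 - ((α + 2 * β * (n + 1 : ℕ)) * s + β * s ^ 2) =
      -(2 * β * s) := by push_cast; ring
    rw [e3, abs_neg, abs_mul, abs_mul, abs_two, abs_of_pos hs.1]
    have : |β| * s ≤ |β| := mul_le_of_le_one_right (abs_nonneg _) hs.2
    nlinarith [pi_pos]
  have hmain : ∑ n ∈ range N, e (α * n + β * (n : ℝ) ^ 2) -
      ∫ u in (0 : ℝ)..N, e (α * u + β * u ^ 2) =
      ∑ n ∈ range N, e (α * n + β * (n : ℝ) ^ 2) * y n := by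
    rw [integral_quadratic_eq_sum, ← sum_sub_distrib]
    refine sum_congr rfl fun n _ => ?_
    simp only [hy, hW]
    ring
  have h := norm_sum_mul_le (fun n => e (α * n + β * (n : ℝ) ^ 2)) w y
    (fun n => (norm_e _).le) (e_quadratic_succ α β) hε0.le N (fun n _ => by positivity)
  rw [hmain]
  refine h.trans ?_
  have hs0 : 0 < √ε := Real.sqrt_pos.2 hε0
  have hb : ∀ n ≤ N, ‖y n‖ / p n ≤ 4 * π := fun n hn => by
    rw [div_le_iff₀ (hp0 n)]
    exact hyn n hn
  have hterm : ∀ n ∈ range N, ‖y (n + 1) - y n‖ / √(‖w (n + 1)‖ ^ 2 + ε) +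
        ‖y n‖ * (‖w (n + 1) - w n‖ / (√(‖w n‖ ^ 2 + ε) * √(‖w (n + 1)‖ ^ 2 + ε))) +
        ‖y n‖ * (ε / (‖w n‖ ^ 2 + ε)) ≤ (8 * π + 16 * π ^ 2) * √ε := by
    intro n hn
    have hn := (mem_range.1 hn).le
    have hεs : ε = √ε * √ε := (Real.mul_self_sqrt hε0.le).symm
    have hpn := hp0 n
    have hpn1 := hp0 (n + 1)
    have t0 : ∀ n, |β| / p n ≤ √ε := fun n => by
      rw [div_le_iff₀ (hp0 n)]
      calc |β| ≤ √ε * √ε := hεs ▸ hβε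
        _ ≤ √ε * p n := by gcongr; exact hεp n
    have t1 : ‖y (n + 1) - y n‖ / p (n + 1) ≤ 4 * π * √ε := by
      calc _ ≤ 4 * π * |β| / p (n + 1) := by gcongr; exact hyd n
        _ = 4 * π * (|β| / p (n + 1)) := by ring
        _ ≤ _ := by gcongr; exact t0 _
    have t2 : ‖y n‖ * (‖w (n + 1) - w n‖ / (p n * p (n + 1))) ≤ 16 * π ^ 2 * √ε := by
      calc _ = ‖y n‖ / p n * (‖w (n + 1) - w n‖ / p (n + 1)) := by field_simp
        _ ≤ 4 * π * (4 * π * |β| / p (n + 1)) := by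
          gcongr
          · exact hb n hn
          · exact norm_incr_succ_sub_le α β n
        _ = 16 * π ^ 2 * (|β| / p (n + 1)) := by ring
        _ ≤ _ := by gcongr; exact t0 _
    have t3 : ‖y n‖ * (ε / p n ^ 2) ≤ 4 * π * √ε := by
      calc _ = ‖y n‖ / p n * (ε / p n) := by field_simp
        _ ≤ 4 * π * √ε := by
          gcongr
          · exact hb n hn
          · rw [div_le_iff₀ hpn]
            nlinarith [hεp n]
    rw [hpsq n]
    change ‖y (n + 1) - y n‖ / p (n + 1) + ‖y n‖ * (‖w (n + 1) - w n‖ / (√(p n ^ 2) * p (n + 1))) +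
      ‖y n‖ * (ε / p n ^ 2) ≤ _
    rw [Real.sqrt_sq hpn.le]
    linarith
  have hsum := sum_le_card_nsmul _ _ _ hterm
  rw [card_range, nsmul_eq_mul] at hsum
  have hNs : N * √ε ≤ 1 + N * √|β| := by
    have : √ε ≤ √|β| + 1 / N := by
      rw [Real.sqrt_le_left (by positivity), hε, add_sq, Real.sq_sqrt (abs_nonneg β), one_div_pow]
      linarith [show 0 ≤ 2 * √|β| * (1 / N) by positivity]
    calc N * √ε ≤ N * (√|β| + 1 / N) := by gcongr
      _ = _ := by field_simp; ring
  have hX : 0 ≤ N * √|β| := by positivity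
  have h1 := hb 0 (Nat.zero_le _)
  have h2 := hb N le_rfl
  calc _ ≤ 4 * π + 4 * π + N * ((8 * π + 16 * π ^ 2) * √ε) := add_le_add (add_le_add h1 h2) hsum
    _ = 8 * π + (8 * π + 16 * π ^ 2) * (N * √ε) := by ring
    _ ≤ 8 * π * (1 + N * √|β|) + (8 * π + 16 * π ^ 2) * (1 + N * √|β|) := by
        exact add_le_add (le_mul_of_one_le_right (by positivity) (by linarith))
          (mul_le_mul_of_nonneg_left hNs (by positivity))
    _ = _ := by ring

/-- The bound for a sum of a quadratic phase with a stationary point. -/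
theorem div_sqrt_le_of_le {q N β : ℝ} (hq : 0 < q) (h : 1 / 32 ≤ q * (N * |β|)) :
    1 / √|β| ≤ 32 * (q * (1 + N * √|β|)) := by
  have hβ : 0 < |β| := by
    by_contra h0
    have : |β| = 0 := le_antisymm (not_lt.1 h0) (abs_nonneg _)
    rw [this] at h
    norm_num at h
  have hs := Real.sqrt_pos.2 hβ
  rw [div_le_iff₀ hs]
  have := Real.mul_self_sqrt hβ.le
  nlinarith [mul_pos hq hs]

theorem abs_increment_sub_le {q β : ℝ} {N n : ℕ} {κ : ℝ} (hn : n ≤ N) (hN : 1 ≤ N)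
    (h : N * |β| ≤ κ / q) : |β * (2 * (n : ℝ) + 1)| ≤ 3 * κ / q := by
  have hn' : (n : ℝ) ≤ N := by exact_mod_cast hn
  have hN' : (1 : ℝ) ≤ N := by exact_mod_cast hN
  rw [abs_mul, abs_of_nonneg (show (0 : ℝ) ≤ 2 * n + 1 by positivity)]
  calc |β| * (2 * n + 1) ≤ 3 * (N * |β|) := by nlinarith [abs_nonneg β]
    _ ≤ 3 * (κ / q) := by gcongr
    _ = _ := by ring

theorem exists_norm_sum_quadratic_frequency_le : ∃ C > 0, ∀ (q N : ℕ) (β₁ β₂ : ℝ) (k : ℤ), 1 ≤ q →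
    |β₁| ≤ 1 / (2 * q) → N * |β₂| ≤ 64 / q → k ≠ 0 → 2 * |(k : ℝ)| ≤ q →
    ‖∑ n ∈ range N, e ((β₁ - k / q) * n + β₂ * (n : ℝ) ^ 2)‖ ≤ C * (q * (1 + N * √|β₂|)) := by
  obtain ⟨C, hC, hvdc⟩ := exists_norm_sum_quadratic_le
  refine ⟨32 * C + 6, by positivity,
    fun q N β₁ β₂ k hq h₁ h₂ hk hkq => ?_⟩
  have hq1 : (1 : ℝ) ≤ q := by exact_mod_cast hq
  have hq0 : (0 : ℝ) < q := by linarith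
  have hX : 0 ≤ N * √|β₂| := by positivity
  rcases Nat.eq_zero_or_pos N with rfl | hN
  · simp only [range_zero, sum_empty, norm_zero]
    positivity
  have hkq' : |(k : ℝ) / q| ≤ 1 / 2 := by
    rw [abs_div, abs_of_pos hq0, div_le_iff₀ hq0]
    linarith
  have hk1 : (1 : ℝ) ≤ |(k : ℝ)| := by exact_mod_cast Int.one_le_abs hk
  have hq2 : (2 : ℝ) ≤ q := by linarith
  have h12 : 1 / (2 * (q : ℝ)) ≤ 1 / 4 := by
    rw [div_le_div_iff₀ (by positivity) (by norm_num)]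
    linarith
  rcases le_or_gt (1 / 32) (q * (N * |β₂|)) with hst | hst
  · have hβ : β₂ ≠ 0 := by
      rintro rfl
      norm_num at hst
    refine (hvdc N _ β₂ hβ ?_ ?_).trans ?_
    · exact (abs_sub _ _).trans (by linarith)
    · refine h₂.trans ?_
      rw [div_le_iff₀ hq0]
      linarith
    · rw [div_eq_mul_one_div]
      calc C * (1 / √|β₂|) ≤ C * (32 * (q * (1 + N * √|β₂|))) := by
            gcongr
            exact div_sqrt_le_of_le hq0 hst
        _ ≤ _ := by
            have : 0 ≤ q * (1 + N * √|β₂|) := by positivity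
            nlinarith
  · have hst' : N * |β₂| ≤ (1 / 32) / q := by
      rw [le_div_iff₀ hq0]
      linarith
    have hw : ∀ n ≤ N, 1 / (q : ℝ) ≤ ‖incr (β₁ - k / q) β₂ n‖ := by
      intro n hn
      have hb := abs_increment_sub_le hn hN hst'
      have e1 : |β₁ + β₂ * (2 * (n : ℝ) + 1)| ≤ 19 / 32 / q := by
        refine (abs_add_le _ _).trans ((add_le_add h₁ hb).trans (le_of_eq ?_))
        field_simp
        norm_num
      have e2 : β₁ - k / q + β₂ * (2 * (n : ℝ) + 1) = (β₁ + β₂ * (2 * (n : ℝ) + 1)) - k / q := by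
        ring
      have e3 : 1 / (q : ℝ) ≤ |(k : ℝ) / q| := by
        rw [abs_div, abs_of_pos hq0]
        gcongr
      have e4 : 19 / 32 / (q : ℝ) = 19 / 32 * (1 / q) := by ring
      have e5 : 1 / (q : ℝ) ≤ 1 / 2 := by gcongr
      have e6 : 0 < 1 / (q : ℝ) := by positivity
      have := four_mul_le_norm_e_sub_one (x := β₁ - k / q + β₂ * (2 * (n : ℝ) + 1))
        (m := 1 / 4 * (1 / q)) (by
          rw [e2, abs_sub_comm]
          linarith [abs_sub_abs_le_abs_sub ((k : ℝ) / q) (β₁ + β₂ * (2 * (n : ℝ) + 1))])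
        (by
          rw [e2]
          linarith [abs_sub (β₁ + β₂ * (2 * (n : ℝ) + 1)) ((k : ℝ) / q)])
      rw [incr]
      linarith
    have h := norm_sum_mul_le_of_le
      (fun n => e ((β₁ - k / q) * n + β₂ * (n : ℝ) ^ 2)) (incr (β₁ - k / q) β₂) (fun _ => 1)
      (fun n => (norm_e _).le) (e_quadratic_succ _ _) N (one_div_pos.2 hq0) hw (Y := 1) (Y' := 0)
      (fun n _ => by simp) (fun n => by simp) (norm_incr_succ_sub_le _ _)
    simp only [mul_one] at h
    refine h.trans ?_
    have e1 : 2 * (1 / (1 / (q : ℝ))) + N * (0 / (1 / (q : ℝ)) +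
        1 * (4 * π * |β₂| / (1 / (q : ℝ) * (1 / q)))) = 2 * q + 4 * π * q * (q * (N * |β₂|)) := by
      field_simp
      ring
    rw [e1]
    have e2 : 4 * π * q * (q * (N * |β₂|)) ≤ 4 * π * q * (1 / 32) := by gcongr
    have e3 : 4 * π * q * (1 / 32) ≤ 4 * q := by nlinarith [pi_lt_four]
    have e4 : 0 ≤ q * (N * √|β₂|) := by positivity
    nlinarith

theorem exists_norm_sum_sub_integral_of_abs_le : ∃ C > 0, ∀ (q N : ℕ) (β₁ β₂ : ℝ), 1 ≤ q →
    |β₁| ≤ 1 / (2 * q) → N * |β₂| ≤ 64 / q →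
    ‖∑ n ∈ range N, e (β₁ * n + β₂ * (n : ℝ) ^ 2) -
      ∫ u in (0 : ℝ)..N, e (β₁ * u + β₂ * u ^ 2)‖ ≤ C * (q * (1 + N * √|β₂|)) := by
  obtain ⟨C, hC, hvdc⟩ := exists_norm_sum_quadratic_le
  obtain ⟨D, hD, hem⟩ := exists_norm_sum_sub_integral_le
  refine ⟨32 * (C + 10) + D, by positivity, fun q N β₁ β₂ hq h₁ h₂ => ?_⟩
  have hq1 : (1 : ℝ) ≤ q := by exact_mod_cast hq
  have hq0 : (0 : ℝ) < q := by linarith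
  have hX : 0 ≤ N * √|β₂| := by positivity
  have hZ : 0 ≤ q * (1 + N * √|β₂|) := by positivity
  rcases Nat.eq_zero_or_pos N with rfl | hN
  · simp only [range_zero, sum_empty, Nat.cast_zero, intervalIntegral.integral_same, sub_zero,
      norm_zero]
    positivity
  have hN1 : (1 : ℝ) ≤ N := by exact_mod_cast hN
  have h12 : 1 / (2 * (q : ℝ)) ≤ 1 / 2 := by
    rw [div_le_div_iff₀ (by positivity) (by norm_num)]
    linarith
  rcases le_or_gt (1 / 32) (q * (N * |β₂|)) with hst | hst
  · have hβ : β₂ ≠ 0 := by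
      rintro rfl
      norm_num at hst
    have e1 := hvdc N β₁ β₂ hβ (by linarith) (h₂.trans (by
      rw [div_le_iff₀ hq0]
      linarith))
    have e2 := norm_integral_quadratic_le hβ β₁ (Nat.cast_nonneg N)
    calc _ ≤ C / √|β₂| + 10 / √|β₂| := (norm_sub_le _ _).trans (add_le_add e1 e2)
      _ = (C + 10) * (1 / √|β₂|) := by ring
      _ ≤ (C + 10) * (32 * (q * (1 + N * √|β₂|))) := by
          gcongr
          exact div_sqrt_le_of_le hq0 hst
      _ ≤ _ := by nlinarith
  · have hst' : N * |β₂| ≤ (1 / 32) / q := by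
      rw [le_div_iff₀ hq0]
      linarith
    have hc : 1 / (q : ℝ) ≤ 1 := by rw [div_le_one hq0]; exact hq1
    refine (hem N β₁ β₂ ?_ fun n hn => ?_).trans ?_
    · have : (1 / 32) / (q : ℝ) = 1 / 32 * (1 / q) := by ring
      nlinarith [abs_nonneg β₂]
    · refine (abs_add_le _ _).trans ((add_le_add h₁ (abs_increment_sub_le hn hN hst')).trans ?_)
      have : 1 / (2 * (q : ℝ)) + 3 * (1 / 32) / q = 19 / 32 * (1 / q) := by
        field_simp
        norm_num
      linarith
    · have : 1 + N * √|β₂| ≤ q * (1 + N * √|β₂|) := by nlinarith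
      nlinarith

theorem exists_norm_sum_quadratic_mul_incr_le : ∃ C > 0, ∀ (q N : ℕ) (β₁ β₂ : ℝ) (k : ℤ), 1 ≤ q →
    |β₁| ≤ 1 / (2 * q) → N * |β₂| ≤ 64 / q → 386 ≤ |(k : ℝ)| → 2 * |(k : ℝ)| ≤ q →
    ‖∑ n ∈ range N, e ((β₁ - k / q) * n + β₂ * (n : ℝ) ^ 2) * incr β₁ β₂ n‖ ≤ C / |(k : ℝ)| := by
  refine ⟨386 * π + 128 * π + 193 * 128 * π ^ 2, by positivity,
    fun q N β₁ β₂ k hq h₁ h₂ hk hkq => ?_⟩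
  have hq1 : (1 : ℝ) ≤ q := by exact_mod_cast hq
  have hq0 : (0 : ℝ) < q := by linarith
  set K := |(k : ℝ)| with hK
  have hK0 : 0 < K := by linarith
  rcases Nat.eq_zero_or_pos N with rfl | hN
  · simp only [range_zero, sum_empty, norm_zero]
    positivity
  have e1 : ∀ n ≤ N, |β₁ + β₂ * (2 * (n : ℝ) + 1)| ≤ 193 / q := fun n hn => by
    refine (abs_add_le _ _).trans ((add_le_add h₁ (abs_increment_sub_le hn hN h₂)).trans ?_)
    have : 193 / (q : ℝ) - (1 / (2 * q) + 3 * 64 / q) = 1 / (2 * q) := by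
      field_simp
      norm_num
    linarith [show 0 < 1 / (2 * (q : ℝ)) by positivity]
  have hKq : |(k : ℝ) / q| = K / q := by rw [abs_div, abs_of_pos hq0]
  have hKq2 : K / q ≤ 1 / 2 := by
    rw [div_le_iff₀ hq0]
    linarith
  have hKq3 : 193 / (q : ℝ) ≤ K / q / 2 := by
    rw [div_div, div_le_div_iff₀ hq0 (by positivity)]
    nlinarith
  have hw : ∀ n ≤ N, 2 * (K / q) ≤ ‖incr (β₁ - k / q) β₂ n‖ := by
    intro n hn
    have h1 := e1 n hn
    have e2 : β₁ - k / q + β₂ * (2 * (n : ℝ) + 1) = (β₁ + β₂ * (2 * (n : ℝ) + 1)) - k / q := by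
      ring
    have := four_mul_le_norm_e_sub_one (x := β₁ - k / q + β₂ * (2 * (n : ℝ) + 1))
        (m := K / q / 2) (by
          rw [e2, abs_sub_comm]
          linarith [abs_sub_abs_le_abs_sub ((k : ℝ) / q) (β₁ + β₂ * (2 * (n : ℝ) + 1))])
        (by
          rw [e2]
          linarith [abs_sub (β₁ + β₂ * (2 * (n : ℝ) + 1)) ((k : ℝ) / q)])
    rw [incr]
    linarith
  have hy : ∀ n ≤ N, ‖incr β₁ β₂ n‖ ≤ 2 * π * (193 / q) := fun n hn => by
    refine (norm_e_sub_one_le _).trans ?_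
    gcongr
    exact e1 n hn
  have h := norm_sum_mul_le_of_le
    (fun n => e ((β₁ - k / q) * n + β₂ * (n : ℝ) ^ 2)) (incr (β₁ - k / q) β₂) (incr β₁ β₂)
    (fun n => (norm_e _).le) (e_quadratic_succ _ _) N (show 0 < 2 * (K / q) by positivity) hw hy
    (norm_incr_succ_sub_le _ _) (norm_incr_succ_sub_le _ _)
  refine h.trans ?_
  have e3 : 2 * (2 * π * (193 / q) / (2 * (K / q))) + N * (4 * π * |β₂| / (2 * (K / q)) +
      2 * π * (193 / q) * (4 * π * |β₂| / (2 * (K / q) * (2 * (K / q))))) =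
      386 * π / K + 2 * π * q / K * (N * |β₂|) + 386 * π ^ 2 * q / K ^ 2 * (N * |β₂|) := by
    field_simp
    ring
  rw [e3]
  have hK1 : 1 ≤ K := by linarith
  calc _ ≤ 386 * π / K + 2 * π * q / K * (64 / q) + 386 * π ^ 2 * q / K ^ 2 * (64 / q) := by gcongr
    _ = 386 * π / K + 128 * π / K + 193 * 128 * π ^ 2 / (K * K) := by
        field_simp
        ring
    _ ≤ 386 * π / K + 128 * π / K + 193 * 128 * π ^ 2 / (K * 1) := by gcongr
    _ = _ := by ring

theorem sub_one_mul_sum_pow_mul (w : ℂ) (g : ℕ → ℂ) (N : ℕ) :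
    (w - 1) * ∑ n ∈ range N, w ^ n * g n =
      w ^ N * g N - g 0 - w * ∑ n ∈ range N, w ^ n * (g (n + 1) - g n) := by
  induction N with
  | zero => simp
  | succ N ih =>
    rw [sum_range_succ, sum_range_succ, mul_add, ih]
    ring

/-- A trigonometric polynomial with period `q` and mean zero is bounded by twice its oscillation. -/
theorem norm_trigPoly_le {ι : Type*} (s : Finset ι) {q : ℕ} (hq : 1 ≤ q) (w d : ι → ℂ)
    (hw : ∀ k ∈ s, w k ^ q = 1) (hw1 : ∀ k ∈ s, w k ≠ 1) {L : ℝ}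
    (hL : ∀ m ≤ q, ‖∑ k ∈ s, d k * w k ^ m - ∑ k ∈ s, d k‖ ≤ L) :
    ‖∑ k ∈ s, d k‖ ≤ L ∧ ∀ N, ‖∑ k ∈ s, d k * w k ^ N‖ ≤ 2 * L := by
  have hq0 : (0 : ℝ) < q := by exact_mod_cast hq
  have hmean : ∑ m ∈ range q, ∑ k ∈ s, d k * w k ^ m = 0 := by
    rw [sum_comm]
    refine sum_eq_zero fun k hk => ?_
    rw [← mul_sum, geom_sum_eq (hw1 k hk), hw k hk]
    simp
  have h0 : ‖∑ k ∈ s, d k‖ ≤ L := by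
    have h := norm_sum_le_of_le (range q)
      (f := fun m => ∑ k ∈ s, d k * w k ^ m - ∑ k ∈ s, d k) (n := fun _ => L)
      fun m hm => hL m (mem_range.1 hm).le
    rw [sum_sub_distrib, hmean, sum_const, sum_const, card_range, zero_sub, norm_neg,
      nsmul_eq_mul, nsmul_eq_mul, norm_mul, Complex.norm_natCast] at h
    exact le_of_mul_le_mul_left h hq0
  refine ⟨h0, fun N => ?_⟩
  have hper : ∑ k ∈ s, d k * w k ^ N = ∑ k ∈ s, d k * w k ^ (N % q) :=
    sum_congr rfl fun k hk => by rw [pow_eq_pow_mod N (hw k hk)]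
  rw [hper]
  have h1 := hL (N % q) (Nat.mod_lt _ hq).le
  calc _ = ‖(∑ k ∈ s, d k * w k ^ (N % q) - ∑ k ∈ s, d k) + ∑ k ∈ s, d k‖ := by
        rw [sub_add_cancel]
    _ ≤ L + L := norm_add_le_of_le h1 h0
    _ = _ := by ring

theorem e_neg_div_pow (q : ℝ) (k : ℤ) (n : ℕ) : e (-(k / q)) ^ n = e (-(k / q) * n) := by
  induction n with
  | zero => simp
  | succ n ih =>
    rw [pow_succ, ih, ← e_add]
    congr 1
    push_cast
    ring

theorem e_neg_div_pow_self {q : ℕ} (hq : 1 ≤ q) (k : ℤ) : e (-(k / (q : ℝ))) ^ q = 1 := by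
  have hq0 : (q : ℝ) ≠ 0 := by positivity
  rw [e_neg_div_pow, ← e_int (-k)]
  congr 1
  push_cast
  field_simp

theorem four_mul_le_norm_e_neg_div_sub_one {q : ℝ} (hq : 0 < q) {k : ℤ} (hk : 2 * |(k : ℝ)| ≤ q) :
    4 * (|(k : ℝ)| / q) ≤ ‖e (-(k / q)) - 1‖ := by
  have h : |(-(k / q) : ℝ)| = |(k : ℝ)| / q := by rw [abs_neg, abs_div, abs_of_pos hq]
  rw [← h]
  refine four_mul_abs_le_norm_e_sub_one ?_
  rw [h, div_le_iff₀ hq]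
  linarith

/-- Transfer from incomplete sums of a `q`-periodic function `c` to sums of `c` against a slowly
varying quadratic phase. -/
theorem exists_norm_sum_periodic_mul_sub_le : ∃ C > 0, ∀ (q N : ℕ) (β₁ β₂ K : ℝ) (H : Finset ℤ)
    (d : ℤ → ℂ) (c : ℕ → ℂ), 1 ≤ q → |β₁| ≤ 1 / (2 * q) → N * |β₂| ≤ 64 / q → 0 ∈ H →
    (∀ k ∈ H, 2 * |(k : ℝ)| ≤ q) → (∀ k, ‖d k‖ ≤ 2 / √q) →
    (∀ n, c n = ∑ k ∈ H, d k * e (-(k / q)) ^ n) →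
    (∀ m ≤ q, ‖∑ n ∈ range m, c n‖ ≤ K * √q) →
    ‖∑ n ∈ range N, c n * e (β₁ * n + β₂ * (n : ℝ) ^ 2) -
      d 0 * ∫ u in (0 : ℝ)..N, e (β₁ * u + β₂ * u ^ 2)‖ ≤
      3 * K * √q + C * (√q * (1 + N * √|β₂|)) := by
  obtain ⟨C₁, hC₁, hfreq⟩ := exists_norm_sum_quadratic_frequency_le
  obtain ⟨C₂, hC₂, hint⟩ := exists_norm_sum_sub_integral_of_abs_le
  obtain ⟨C₃, hC₃, hincr⟩ := exists_norm_sum_quadratic_mul_incr_le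
  set T : ℝ := ∑' k : ℤ, 1 / (k : ℝ) ^ 2 with hT
  have hT0 : 0 ≤ T := tsum_nonneg fun k => by positivity
  refine ⟨771 * (2 * (C₁ + C₂)) + 3 * 1542 + C₃ * T, by positivity, ?_⟩
  intro q N β₁ β₂ K H d c hq h₁ h₂ h0H hH hd hc hK
  have hq0 : (0 : ℝ) < q := by exact_mod_cast hq
  have hs : 0 < √(q : ℝ) := Real.sqrt_pos.2 hq0
  have hss : √(q : ℝ) * √q = q := Real.mul_self_sqrt hq0.le
  have hdq : ∀ k, ‖d k‖ * q ≤ 2 * √q := fun k => by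
    calc ‖d k‖ * q ≤ 2 / √q * q := by gcongr; exact hd k
      _ = 2 / √q * (√q * √q) := by rw [hss]
      _ = _ := by field_simp
  set X := N * √|β₂| with hX
  have hX0 : 0 ≤ X := by positivity
  set g : ℕ → ℂ := fun n => e (β₁ * n + β₂ * (n : ℝ) ^ 2) with hg
  set I := ∫ u in (0 : ℝ)..N, e (β₁ * u + β₂ * u ^ 2) with hI
  set w : ℤ → ℂ := fun k => e (-(k / (q : ℝ))) with hw
  have hwg : ∀ k n, w k ^ n * g n = e ((β₁ - k / q) * n + β₂ * (n : ℝ) ^ 2) := fun k n => by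
    rw [hw, hg]
    simp only
    rw [e_neg_div_pow, ← e_add]
    congr 1
    ring
  set E : ℤ → ℂ := fun k => ∑ n ∈ range N, w k ^ n * g n with hE
  set Hs := H.filter fun k => |k| < 386 with hHs
  set Hb := H.filter fun k => ¬ |k| < 386 with hHb
  have hcard : (Hs.card : ℝ) ≤ 771 := by
    have : Hs ⊆ Finset.Ioo (-386) 386 := fun k hk => by
      simpa [abs_lt] using (mem_filter.1 hk).2
    have := card_le_card this
    rw [Int.card_Ioo] at this
    exact_mod_cast this
  have hbig : ∀ k ∈ Hb, 386 ≤ |(k : ℝ)| := fun k hk => by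
    have := not_lt.1 (mem_filter.1 hk).2
    exact_mod_cast this
  have hbigq : ∀ k ∈ Hb, 2 * |(k : ℝ)| ≤ q := fun k hk => hH k (mem_filter.1 hk).1
  have hw4 : ∀ k ∈ Hb, 4 * (|(k : ℝ)| / q) ≤ ‖w k - 1‖ := fun k hk =>
    four_mul_le_norm_e_neg_div_sub_one hq0 (hbigq k hk)
  have hw1 : ∀ k ∈ Hb, w k ≠ 1 := fun k hk h => by
    have h4 := hw4 k hk
    have := hbig k hk
    rw [h, sub_self, norm_zero] at h4
    have : 0 < |(k : ℝ)| / q := div_pos (by linarith) hq0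
    linarith
  have hsplit : ∑ n ∈ range N, c n * g n = ∑ k ∈ Hs, d k * E k + ∑ k ∈ Hb, d k * E k := by
    rw [hHs, hHb, sum_filter_add_sum_filter_not]
    simp only [hc, sum_mul, hE, mul_sum]
    rw [sum_comm]
    exact sum_congr rfl fun k _ => sum_congr rfl fun n _ => by ring
  have hsmall : ‖∑ k ∈ Hs, d k * E k - d 0 * I‖ ≤ 771 * (2 * (C₁ + C₂) * (√q * (1 + X))) := by
    have h0 : (0 : ℤ) ∈ Hs := mem_filter.2 ⟨h0H, by norm_num⟩
    have hrew : ∑ k ∈ Hs, d k * E k - d 0 * I =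
        ∑ k ∈ Hs, d k * (E k - if k = 0 then I else 0) := by
      simp only [mul_sub, sum_sub_distrib, mul_ite, mul_zero]
      rw [sum_ite_eq' Hs 0 (fun k => d k * I), if_pos h0]
    rw [hrew]
    have hterm : ∀ k ∈ Hs, ‖d k * (E k - if k = 0 then I else 0)‖ ≤
        2 * (C₁ + C₂) * (√q * (1 + X)) := fun k hk => by
      have hb : ‖E k - if k = 0 then I else 0‖ ≤ (C₁ + C₂) * (q * (1 + X)) := by
        have hqX : 0 ≤ q * (1 + X) := by positivity
        split_ifs with hk0
        · have := hint q N β₁ β₂ hq h₁ h₂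
          have hE0 : E k = ∑ n ∈ range N, e (β₁ * n + β₂ * (n : ℝ) ^ 2) := by
            rw [hE]
            refine sum_congr rfl fun n _ => ?_
            rw [hwg, hk0]
            simp
          rw [hE0]
          nlinarith
        · have := hfreq q N β₁ β₂ k hq h₁ h₂ hk0 (hH k (mem_filter.1 hk).1)
          have hE0 : E k = ∑ n ∈ range N, e ((β₁ - k / q) * n + β₂ * (n : ℝ) ^ 2) :=
            sum_congr rfl fun n _ => hwg k n
          rw [hE0, sub_zero]
          nlinarith
      rw [norm_mul]
      calc _ ≤ ‖d k‖ * ((C₁ + C₂) * (q * (1 + X))) := by gcongr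
        _ = ‖d k‖ * q * ((C₁ + C₂) * (1 + X)) := by ring
        _ ≤ 2 * √q * ((C₁ + C₂) * (1 + X)) :=
          mul_le_mul_of_nonneg_right (hdq k) (by positivity)
        _ = _ := by ring
    refine (norm_sum_le_of_le _ hterm).trans ?_
    rw [sum_const, nsmul_eq_mul]
    gcongr
  set B : ℕ → ℂ := fun m => ∑ k ∈ Hb, d k / (w k - 1) * w k ^ m with hB
  set L := (K + 1542) * √(q : ℝ) with hL
  have hosc : ∀ m ≤ q, ‖∑ k ∈ Hb, d k / (w k - 1) * w k ^ m - ∑ k ∈ Hb, d k / (w k - 1)‖ ≤ L := by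
    intro m hm
    have h1 : ∑ k ∈ Hb, d k / (w k - 1) * w k ^ m - ∑ k ∈ Hb, d k / (w k - 1) =
        ∑ n ∈ range m, c n - ∑ k ∈ Hs, d k * ∑ n ∈ range m, w k ^ n := by
      have h2 : ∑ n ∈ range m, c n = ∑ k ∈ H, d k * ∑ n ∈ range m, w k ^ n := by
        simp only [hc, mul_sum]
        rw [sum_comm]
      rw [h2, ← sum_filter_add_sum_filter_not H (fun k => |k| < 386), add_sub_cancel_left,
        ← sum_sub_distrib]
      refine sum_congr rfl fun k hk => ?_
      rw [geom_sum_eq (hw1 k hk)]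
      ring
    have h3 : ‖∑ k ∈ Hs, d k * ∑ n ∈ range m, w k ^ n‖ ≤ 771 * (2 * √q) := by
      have hterm : ∀ k ∈ Hs, ‖d k * ∑ n ∈ range m, w k ^ n‖ ≤ 2 * √q := fun k _ => by
        have : ‖∑ n ∈ range m, w k ^ n‖ ≤ q := by
          refine (norm_sum_le_of_le _ (n := fun _ => (1 : ℝ)) fun n _ => ?_).trans ?_
          · rw [norm_pow, hw]
            simp
          · simpa using hm
        rw [norm_mul]
        exact (mul_le_mul_of_nonneg_left this (norm_nonneg _)).trans (hdq k)
      refine (norm_sum_le_of_le _ hterm).trans ?_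
      rw [sum_const, nsmul_eq_mul]
      gcongr
    rw [h1]
    refine (norm_sub_le_of_le (hK m hm) h3).trans (le_of_eq ?_)
    rw [hL]
    ring
  obtain ⟨hB0, hBN⟩ := norm_trigPoly_le Hb hq w (fun k => d k / (w k - 1))
    (fun k _ => e_neg_div_pow_self hq k) hw1 hosc
  set R : ℤ → ℂ := fun k => ∑ n ∈ range N, w k ^ n * (g (n + 1) - g n) with hR
  have hRb : ∀ k ∈ Hb, ‖R k‖ ≤ C₃ / |(k : ℝ)| := fun k hk => by
    have : R k = ∑ n ∈ range N, e ((β₁ - k / q) * n + β₂ * (n : ℝ) ^ 2) * incr β₁ β₂ n := by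
      refine sum_congr rfl fun n _ => ?_
      rw [← hwg, mul_assoc]
      congr 1
      have := e_quadratic_succ β₁ β₂ n
      rw [hg]
      simp only [Nat.cast_add, Nat.cast_one] at this ⊢
      rw [this]
      ring
    rw [this]
    exact hincr q N β₁ β₂ k hq h₁ h₂ (hbig k hk) (hbigq k hk)
  have hbigsum : ∑ k ∈ Hb, d k * E k = (∑ k ∈ Hb, d k / (w k - 1) * w k ^ N) * g N -
      (∑ k ∈ Hb, d k / (w k - 1)) - ∑ k ∈ Hb, d k / (w k - 1) * w k * R k := by
    rw [sum_mul, ← sum_sub_distrib, ← sum_sub_distrib]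
    refine sum_congr rfl fun k hk => ?_
    have h := sub_one_mul_sum_pow_mul (w k) g N
    have hne : w k - 1 ≠ 0 := sub_ne_zero.2 (hw1 k hk)
    have hg0 : g 0 = 1 := by simp [hg]
    rw [hg0] at h
    have : E k = (w k ^ N * g N - 1 - w k * R k) / (w k - 1) := by
      rw [eq_div_iff hne, mul_comm]
      exact h
    rw [this]
    field_simp
  have hrem : ‖∑ k ∈ Hb, d k / (w k - 1) * w k * R k‖ ≤ C₃ * T * √q := by
    have hterm : ∀ k ∈ Hb, ‖d k / (w k - 1) * w k * R k‖ ≤ C₃ * √q * (1 / (k : ℝ) ^ 2) :=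
      fun k hk => by
      have hk0 : 0 < |(k : ℝ)| := by linarith [hbig k hk]
      have hwk : ‖w k‖ = 1 := norm_e _
      rw [norm_mul, norm_mul, norm_div, hwk, mul_one]
      calc _ ≤ ‖d k‖ / (4 * (|(k : ℝ)| / q)) * (C₃ / |(k : ℝ)|) := by
            gcongr
            · exact hw4 k hk
            · exact hRb k hk
        _ = ‖d k‖ * q * (C₃ / (4 * |(k : ℝ)| ^ 2)) := by field_simp
        _ ≤ 2 * √q * (C₃ / (4 * |(k : ℝ)| ^ 2)) :=
            mul_le_mul_of_nonneg_right (hdq k) (by positivity)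
        _ = C₃ * √q * (1 / |(k : ℝ)| ^ 2) / 2 := by ring
        _ ≤ C₃ * √q * (1 / |(k : ℝ)| ^ 2) := half_le_self (by positivity)
        _ = _ := by rw [sq_abs]
    refine (norm_sum_le_of_le _ hterm).trans ?_
    rw [← mul_sum]
    have : ∑ k ∈ Hb, 1 / (k : ℝ) ^ 2 ≤ T :=
      (Real.summable_one_div_int_pow.2 one_lt_two).sum_le_tsum _ fun k _ => by positivity
    calc _ ≤ C₃ * √q * T := by gcongr
      _ = _ := by ring
  have hgN : ‖g N‖ = 1 := norm_e _
  have hbigle : ‖∑ k ∈ Hb, d k * E k‖ ≤ 2 * L + L + C₃ * T * √q := by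
    rw [hbigsum]
    refine norm_sub_le_of_le (norm_sub_le_of_le ?_ hB0) hrem
    rw [norm_mul, hgN, mul_one]
    exact hBN N
  have hqX : 0 ≤ √q * X := by positivity
  calc _ = ‖(∑ k ∈ Hs, d k * E k - d 0 * I) + ∑ k ∈ Hb, d k * E k‖ := by
        rw [hsplit]
        congr 1
        ring
    _ ≤ 771 * (2 * (C₁ + C₂) * (√q * (1 + X))) + (2 * L + L + C₃ * T * √q) :=
        norm_add_le_of_le hsmall hbigle
    _ = 3 * K * √q + (771 * (2 * (C₁ + C₂)) * (√q * (1 + X)) +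
          (3 * 1542 + C₃ * T) * √q) := by rw [hL]; ring
    _ ≤ 3 * K * √q + (771 * (2 * (C₁ + C₂)) * (√q * (1 + X)) +
          (3 * 1542 + C₃ * T) * (√q * (1 + X))) := by
        gcongr
        exact le_mul_of_one_le_right hs.le (by linarith)
    _ = _ := by ring

theorem e_int_div_congr {q : ℕ} (hq : 1 ≤ q) {x y : ℤ} (h : (q : ℤ) ∣ x - y) :
    e ((x : ℝ) / q) = e ((y : ℝ) / q) := by
  have hq0 : (q : ℝ) ≠ 0 := by positivity
  obtain ⟨k, hk⟩ := h
  have hx : (x : ℝ) = y + q * k := by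
    have : x = y + q * k := by linarith
    exact_mod_cast this
  rw [hx, add_div, mul_div_cancel_left₀ _ hq0, e_add, e_int, mul_one]

theorem e_int_div_eq_one_iff {q : ℕ} (hq : 1 ≤ q) (k : ℤ) :
    e ((k : ℝ) / q) = 1 ↔ (q : ℤ) ∣ k := by
  have hq0 : (q : ℝ) ≠ 0 := by positivity
  constructor
  · intro h
    rw [e, Complex.exp_eq_one_iff] at h
    obtain ⟨n, hn⟩ := h
    have h2 : ((k : ℝ) / q : ℝ) = n := by
      have : (2 * π * Complex.I : ℂ) * (((k : ℝ) / q : ℝ) : ℂ) = 2 * π * Complex.I * n := by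
        rw [hn]
        ring
      exact_mod_cast mul_left_cancel₀ Complex.two_pi_I_ne_zero this
    rw [div_eq_iff hq0] at h2
    exact ⟨n, by rw [mul_comm]; exact_mod_cast h2⟩
  · intro h
    rw [e_int_div_congr hq (y := 0) (by simpa using h)]
    simp

theorem e_int_div_pow {q : ℕ} (k : ℤ) (n : ℕ) :
    e ((k : ℝ) / q) ^ n = e (((k * n : ℤ) : ℝ) / q) := by
  have h := e_neg_div_pow q (-k) n
  push_cast at h ⊢
  rw [neg_div, neg_neg] at h
  rw [h]
  congr 1
  ring

theorem geom_sum_e_int_div {q : ℕ} (hq : 1 ≤ q) (k : ℤ) :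
    ∑ n ∈ range q, e ((k : ℝ) / q) ^ n = if (q : ℤ) ∣ k then (q : ℂ) else 0 := by
  split_ifs with h
  · rw [(e_int_div_eq_one_iff hq k).2 h]
    simp
  · rw [geom_sum_eq (mt (e_int_div_eq_one_iff hq k).1 h), e_int_div_pow,
      (e_int_div_eq_one_iff hq _).2 (dvd_mul_left _ _)]
    simp

theorem sum_range_add_of_periodic {M : Type*} [AddCommGroup M] {f : ℕ → M} {q : ℕ}
    (hf : Function.Periodic f q) (s : ℕ) : ∑ r ∈ range q, f (r + s) = ∑ r ∈ range q, f r := by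
  induction s with
  | zero => simp
  | succ s ih =>
    rw [← ih]
    have h1 := sum_range_succ (fun r => f (r + s)) q
    have h2 := sum_range_succ' (fun r => f (r + s)) q
    rw [h1] at h2
    have h3 : f (q + s) = f (0 + s) := by rw [add_comm, hf, zero_add]
    rw [h3] at h2
    rw [add_right_cancel h2]
    exact sum_congr rfl fun r _ => by congr 1; ring

/-- The phase `e ((a n ^ 2 + b n) / q)` of the quadratic Gauss sums modulo `q`. -/
noncomputable def gaussPhase (a b : ℤ) (q n : ℕ) : ℂ :=
  e (((a * (n : ℤ) ^ 2 + b * n : ℤ) : ℝ) / q)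

theorem norm_gaussPhase (a b : ℤ) (q n : ℕ) : ‖gaussPhase a b q n‖ = 1 := norm_e _

theorem gaussPhase_congr (a b : ℤ) {q : ℕ} (hq : 1 ≤ q) {m n : ℕ} (h : (q : ℤ) ∣ (m : ℤ) - n) :
    gaussPhase a b q m = gaussPhase a b q n := by
  refine e_int_div_congr hq ?_
  have : a * (m : ℤ) ^ 2 + b * m - (a * (n : ℤ) ^ 2 + b * n) =
      ((m : ℤ) - n) * (a * (m + n) + b) := by ring
  rw [this]
  exact h.mul_right _

theorem gaussPhase_periodic (a b : ℤ) {q : ℕ} (hq : 1 ≤ q) :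
    Function.Periodic (gaussPhase a b q) q :=
  fun n => gaussPhase_congr a b hq (by simp)

theorem conj_e (x : ℝ) : (starRingEnd ℂ) (e x) = e (-x) := by
  have h : e x * e (-x) = 1 := by rw [← e_add, add_neg_cancel, e_zero]
  have h2 : e x * (starRingEnd ℂ) (e x) = 1 := by
    rw [Complex.mul_conj, Complex.normSq_eq_norm_sq, norm_e]
    simp
  exact mul_left_cancel₀ (left_ne_zero_of_mul_eq_one h) (h2.trans h.symm)

theorem card_filter_dvd_two_mul_le (a : ℤ) {q : ℕ} (ha : IsCoprime a q) :
    ((range q).filter fun s : ℕ => (q : ℤ) ∣ 2 * a * s).card ≤ 2 := by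
  have hsub : ((range q).filter fun s : ℕ => (q : ℤ) ∣ 2 * a * s) ⊆ {0, q / 2} := by
    intro s hs
    obtain ⟨hsq, hdvd⟩ := mem_filter.1 hs
    rw [mem_range] at hsq
    have h1 : (q : ℤ) ∣ 2 * s := by
      refine ha.symm.dvd_of_dvd_mul_left (?_ : (q : ℤ) ∣ a * (2 * s))
      convert hdvd using 1
      ring
    have h2 : q ∣ 2 * s := by exact_mod_cast h1
    obtain ⟨k, hk⟩ := h2
    have hk2 : k < 2 := by
      by_contra hcon
      have : q * 2 ≤ q * k := Nat.mul_le_mul_left q (not_lt.1 hcon)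
      omega
    rw [mem_insert, mem_singleton]
    interval_cases k <;> omega
  exact (card_le_card hsub).trans card_le_two

theorem norm_gaussSum_le (a b : ℤ) {q : ℕ} (hq : 1 ≤ q) (ha : IsCoprime a q) :
    ‖∑ r ∈ range q, gaussPhase a b q r‖ ≤ 2 * √q := by
  set S := ∑ r ∈ range q, gaussPhase a b q r with hS
  have hq0 : (q : ℝ) ≠ 0 := by positivity
  have hprod : ∀ r s, gaussPhase a b q (s + r) * (starRingEnd ℂ) (gaussPhase a b q r) =
      gaussPhase a b q s * e (((2 * a * s : ℤ) : ℝ) / q) ^ r := fun r s => by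
    rw [e_int_div_pow, gaussPhase, gaussPhase, gaussPhase, conj_e, ← e_add, ← e_add]
    congr 1
    push_cast
    field_simp
    ring
  have hSS : S * (starRingEnd ℂ) S = ∑ s ∈ range q, gaussPhase a b q s *
      if (q : ℤ) ∣ 2 * a * s then (q : ℂ) else 0 := by
    calc S * (starRingEnd ℂ) S = ∑ r ∈ range q, S * (starRingEnd ℂ) (gaussPhase a b q r) := by
          conv_lhs => rw [hS, map_sum, mul_sum]
      _ = ∑ r ∈ range q, ∑ s ∈ range q,
            gaussPhase a b q s * e (((2 * a * s : ℤ) : ℝ) / q) ^ r := by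
          refine sum_congr rfl fun r _ => ?_
          rw [hS, ← sum_range_add_of_periodic (gaussPhase_periodic a b hq) r, sum_mul]
          exact sum_congr rfl fun s _ => hprod r s
      _ = _ := by
          rw [sum_comm]
          refine sum_congr rfl fun s _ => ?_
          rw [← mul_sum, geom_sum_e_int_div hq]
  have hbound : ‖S‖ ^ 2 ≤ 2 * q := by
    have h1 : ‖S * (starRingEnd ℂ) S‖ = ‖S‖ ^ 2 := by
      rw [norm_mul, Complex.norm_conj, sq]
    rw [← h1, hSS]
    refine (norm_sum_le_of_le _ (n := fun s : ℕ => if (q : ℤ) ∣ 2 * a * s then (q : ℝ) else 0)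
      fun s _ => ?_).trans ?_
    · rw [norm_mul, norm_gaussPhase, one_mul]
      split_ifs <;> simp
    · rw [← sum_filter, sum_const, nsmul_eq_mul]
      gcongr
      exact_mod_cast card_filter_dvd_two_mul_le a ha
  refine abs_le_of_sq_le_sq' ?_ (by positivity) |>.2
  rw [mul_pow, Real.sq_sqrt (by positivity)]
  linarith [show (0 : ℝ) ≤ q by positivity]

/-- A complete system of residues modulo `q` contained in `[-q / 2, q / 2]`. -/
def symmResidues (q : ℕ) : Finset ℤ := (range q).image fun i : ℕ => (i : ℤ) - (q / 2 : ℕ)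

theorem two_mul_abs_le_of_mem_symmResidues {q : ℕ} {k : ℤ} (hk : k ∈ symmResidues q) :
    2 * |(k : ℝ)| ≤ q := by
  obtain ⟨i, hi, rfl⟩ := mem_image.1 hk
  rw [mem_range] at hi
  have : 2 * |(i : ℤ) - (q / 2 : ℕ)| ≤ q := by
    rcases abs_cases ((i : ℤ) - (q / 2 : ℕ)) with h | h <;> omega
  exact_mod_cast this

theorem zero_mem_symmResidues {q : ℕ} (hq : 1 ≤ q) : 0 ∈ symmResidues q :=
  mem_image.2 ⟨q / 2, mem_range.2 (by omega), by simp⟩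

theorem sum_symmResidues_e {q : ℕ} (hq : 1 ≤ q) (j : ℤ) :
    ∑ k ∈ symmResidues q, e (((j * k : ℤ) : ℝ) / q) = if (q : ℤ) ∣ j then (q : ℂ) else 0 := by
  rw [symmResidues, sum_image fun x _ y _ h => by simpa using h]
  have hterm : ∀ i : ℕ, e (((j * ((i : ℤ) - (q / 2 : ℕ)) : ℤ) : ℝ) / q) =
      e (((j * -(q / 2 : ℕ) : ℤ) : ℝ) / q) * e ((j : ℝ) / q) ^ i := fun i => by
    rw [e_int_div_pow, ← e_add]
    congr 1
    push_cast
    ring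
  simp only [hterm]
  rw [← mul_sum, geom_sum_e_int_div hq]
  split_ifs with h
  · rw [(e_int_div_eq_one_iff hq _).2 (h.mul_right _), one_mul]
  · rw [mul_zero]

/-- Finite Fourier expansion of the quadratic phase modulo `q`. -/
theorem gaussPhase_eq_sum (a b : ℤ) {q : ℕ} (hq : 1 ≤ q) (n : ℕ) :
    gaussPhase a b q n = ∑ k ∈ symmResidues q,
      ((q : ℂ)⁻¹ * ∑ r ∈ range q, gaussPhase a (b + k) q r) * e (-(k / (q : ℝ))) ^ n := by
  have hq0 : (q : ℂ) ≠ 0 := by exact_mod_cast (by omega : q ≠ 0)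
  have hprod : ∀ (k : ℤ) (r : ℕ), gaussPhase a (b + k) q r * e (-(k / (q : ℝ))) ^ n =
      gaussPhase a b q r * e (((((r : ℤ) - n) * k : ℤ) : ℝ) / q) := fun k r => by
    rw [e_neg_div_pow, gaussPhase, gaussPhase, ← e_add, ← e_add]
    congr 1
    push_cast
    ring
  have hsum : ∑ r ∈ range q, gaussPhase a b q r *
      (if (q : ℤ) ∣ (r : ℤ) - n then (q : ℂ) else 0) = gaussPhase a b q n * q := by
    rw [sum_eq_single (n % q)]
    · have h : (q : ℤ) ∣ ((n % q : ℕ) : ℤ) - n := by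
        rw [Int.natCast_mod]
        exact (Int.mod_modEq _ _).symm.dvd
      rw [if_pos h, gaussPhase_congr a b hq h]
    · intro r hr hne
      rw [if_neg, mul_zero]
      intro h
      apply hne
      have : n ≡ r [MOD q] := (Nat.modEq_iff_dvd).2 h
      rw [this, Nat.mod_eq_of_lt (mem_range.1 hr)]
    · intro h
      exact absurd (mem_range.2 (Nat.mod_lt _ hq)) h
  calc gaussPhase a b q n = (q : ℂ)⁻¹ * (gaussPhase a b q n * q) := by field_simp
    _ = (q : ℂ)⁻¹ * ∑ r ∈ range q, ∑ k ∈ symmResidues q,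
          gaussPhase a (b + k) q r * e (-(k / (q : ℝ))) ^ n := by
        rw [← hsum]
        congr 1
        refine sum_congr rfl fun r _ => ?_
        rw [← sum_symmResidues_e hq, mul_sum]
        exact sum_congr rfl fun k _ => (hprod k r).symm
    _ = _ := by
        rw [sum_comm, mul_sum]
        refine sum_congr rfl fun k _ => ?_
        rw [mul_assoc, sum_mul]

theorem norm_fourierCoeff_le (a b : ℤ) {q : ℕ} (hq : 1 ≤ q) (ha : IsCoprime a q) :
    ‖(q : ℂ)⁻¹ * ∑ r ∈ range q, gaussPhase a b q r‖ ≤ 2 / √q := by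
  have hq0 : (0 : ℝ) < q := by exact_mod_cast hq
  have hs : 0 < √(q : ℝ) := Real.sqrt_pos.2 hq0
  rw [norm_mul, norm_inv, Complex.norm_natCast]
  calc _ ≤ (q : ℝ)⁻¹ * (2 * √q) := by
        gcongr
        exact norm_gaussSum_le a b hq ha
    _ = (√q * √q : ℝ)⁻¹ * (2 * √q) := by rw [Real.mul_self_sqrt hq0.le]
    _ = _ := by field_simp

theorem exists_norm_sum_gaussPhase_mul_sub_le : ∃ C > 0, ∀ (q N : ℕ) (a b : ℤ) (β₁ β₂ K : ℝ),
    1 ≤ q → IsCoprime a q → |β₁| ≤ 1 / (2 * q) → N * |β₂| ≤ 64 / q →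
    (∀ m ≤ q, ‖∑ n ∈ range m, gaussPhase a b q n‖ ≤ K * √q) →
    ‖∑ n ∈ range N, gaussPhase a b q n * e (β₁ * n + β₂ * (n : ℝ) ^ 2) -
      (q : ℂ)⁻¹ * (∑ r ∈ range q, gaussPhase a b q r) *
        ∫ u in (0 : ℝ)..N, e (β₁ * u + β₂ * u ^ 2)‖ ≤
      3 * K * √q + C * (√q * (1 + N * √|β₂|)) := by
  obtain ⟨C, hC, h⟩ := exists_norm_sum_periodic_mul_sub_le
  refine ⟨C, hC, fun q N a b β₁ β₂ K hq ha h₁ h₂ hK => ?_⟩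
  have := h q N β₁ β₂ K (symmResidues q)
    (fun k => (q : ℂ)⁻¹ * ∑ r ∈ range q, gaussPhase a (b + k) q r) (gaussPhase a b q) hq h₁ h₂
    (zero_mem_symmResidues hq) (fun k hk => two_mul_abs_le_of_mem_symmResidues hk)
    (fun k => norm_fourierCoeff_le a (b + k) hq ha) (gaussPhase_eq_sum a b hq) hK
  simpa only [add_zero] using this

/-- A rational with small denominator near `a / q`, but distinct from it. -/
theorem exists_near_fraction {q : ℕ} (hq : 64 ≤ q) {a : ℤ} (ha : IsCoprime a q) :
    ∃ (p : ℕ) (c : ℤ), 1 ≤ p ∧ 64 * p ≤ q ∧ IsCoprime c p ∧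
      |(a : ℝ) / q - c / p| ≤ 64 / (q * p) ∧ 1 / (q * p) ≤ |(a : ℝ) / q - c / p| := by
  have hq0 : (0 : ℝ) < q := by
    have : 0 < q := by omega
    exact_mod_cast this
  obtain ⟨r, hr, hden⟩ := Real.exists_rat_abs_sub_le_and_den_le ((a : ℝ) / q)
    (n := q / 64) (by omega)
  have hp : 0 < r.den := r.den_pos
  have hp0 : (0 : ℝ) < r.den := by exact_mod_cast hp
  have hrr : (r : ℝ) = r.num / r.den := Rat.cast_def r
  rw [hrr] at hr
  refine ⟨r.den, r.num, hp, ?_, ?_, hr.trans ?_, ?_⟩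
  · have : (r.den : ℤ) ≤ q / 64 := by exact_mod_cast hden
    omega
  · rw [Int.isCoprime_iff_nat_coprime]
    simpa using r.reduced
  · have h1 : (q : ℝ) ≤ 64 * (((q / 64 : ℕ) : ℝ) + 1) := by
      have : q ≤ 64 * (q / 64 + 1) := by omega
      exact_mod_cast this
    rw [div_le_div_iff₀ (by positivity) (by positivity)]
    nlinarith
  · have hne : a * r.den - r.num * q ≠ 0 := by
      intro h0
      have h1 : (q : ℤ) ∣ a * r.den := ⟨r.num, by linarith⟩
      have h2 : (q : ℤ) ∣ r.den := ha.symm.dvd_of_dvd_mul_left h1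
      have h3 : q ≤ r.den := Nat.le_of_dvd hp (by exact_mod_cast h2)
      have : (r.den : ℤ) ≤ q / 64 := by exact_mod_cast hden
      omega
    have h1 : (1 : ℝ) ≤ |(a : ℝ) * r.den - r.num * q| := by
      exact_mod_cast Int.one_le_abs hne
    have h2 : (a : ℝ) / q - r.num / r.den = (a * r.den - r.num * q) / (q * r.den) := by
      field_simp
    rw [h2, abs_div, abs_of_pos (by positivity : (0 : ℝ) < q * r.den)]
    gcongr

/-- Incomplete quadratic Gauss sums satisfy the same bound as complete ones. -/
theorem exists_norm_sum_gaussPhase_le : ∃ K > 0, ∀ (q : ℕ) (a b : ℤ), 1 ≤ q → IsCoprime a q →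
    ∀ m ≤ q, ‖∑ n ∈ range m, gaussPhase a b q n‖ ≤ K * √q := by
  obtain ⟨C, hC, hmajor⟩ := exists_norm_sum_gaussPhase_mul_sub_le
  refine ⟨32 + 16 * C, by positivity, fun q => ?_⟩
  induction q using Nat.strong_induction_on with
  | _ q ih =>
  intro a b hq ha m hm
  have hq0 : (0 : ℝ) < q := by exact_mod_cast hq
  have hs : 0 < √(q : ℝ) := Real.sqrt_pos.2 hq0
  have hss : √(q : ℝ) * √q = q := Real.mul_self_sqrt hq0.le
  have hmq : (m : ℝ) ≤ q := by exact_mod_cast hm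
  rcases lt_or_ge q 64 with hsmall | hlarge
  · have h8 : √(q : ℝ) ≤ 8 := by
      rw [Real.sqrt_le_left (by norm_num)]
      have : (q : ℝ) < 64 := by exact_mod_cast hsmall
      linarith
    refine (norm_sum_le_of_le _ (n := fun _ => (1 : ℝ))
      fun n _ => (norm_gaussPhase a b q n).le).trans ?_
    rw [sum_const, card_range, nsmul_eq_mul, mul_one]
    nlinarith
  · obtain ⟨p, c, hp, hpq, hc, hub, hlb⟩ := exists_near_fraction hlarge ha
    have hp0 : (0 : ℝ) < p := by exact_mod_cast hp
    have hsp : 0 < √(p : ℝ) := Real.sqrt_pos.2 hp0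
    have hp8 : 8 * √(p : ℝ) ≤ √q := by
      refine Real.le_sqrt_of_sq_le ?_
      rw [mul_pow, Real.sq_sqrt hp0.le]
      have : (64 : ℝ) * p ≤ q := by exact_mod_cast hpq
      linarith
    set d : ℤ := round ((b : ℝ) * p / q) with hd
    set β₁ : ℝ := b / q - d / p with hβ₁
    set β₂ : ℝ := a / q - c / p with hβ₂
    have h₁ : |β₁| ≤ 1 / (2 * p) := by
      have h := abs_sub_round ((b : ℝ) * p / q)
      have h2 : β₁ = ((b : ℝ) * p / q - d) / p := by
        rw [hβ₁]
        field_simp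
      rw [h2, abs_div, abs_of_pos hp0, div_le_div_iff₀ hp0 (by positivity)]
      nlinarith
    have h₂ : m * |β₂| ≤ 64 / p := by
      calc m * |β₂| ≤ q * (64 / (q * p)) := by gcongr
        _ = _ := by field_simp
    have hβ₂0 : 0 < |β₂| := lt_of_lt_of_le (by positivity) hlb
    have hphase : ∀ n : ℕ, gaussPhase a b q n =
        gaussPhase c d p n * e (β₁ * n + β₂ * (n : ℝ) ^ 2) := fun n => by
      rw [gaussPhase, gaussPhase, ← e_add]
      congr 1
      rw [hβ₁, hβ₂]
      push_cast
      field_simp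
      ring
    have hmain := hmajor p m c d β₁ β₂ (32 + 16 * C) hp hc h₁ h₂
      (ih p (by omega) c d hp hc)
    simp only [← hphase] at hmain
    have hlow : 1 / √|β₂| ≤ √q * √p := by
      rw [div_le_iff₀ (Real.sqrt_pos.2 hβ₂0), ← Real.sqrt_mul hq0.le,
        ← Real.sqrt_mul (by positivity)]
      refine Real.le_sqrt_of_sq_le ?_
      rw [div_le_iff₀ (by positivity)] at hlb
      linarith
    have hgauss : ‖(p : ℂ)⁻¹ * (∑ r ∈ range p, gaussPhase c d p r) *
        ∫ u in (0 : ℝ)..m, e (β₁ * u + β₂ * u ^ 2)‖ ≤ 20 * √q := by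
      rw [norm_mul]
      calc _ ≤ 2 / √(p : ℝ) * (10 / √|β₂|) := by
            gcongr
            · exact norm_fourierCoeff_le c d hp hc
            · exact norm_integral_quadratic_le (abs_pos.1 hβ₂0) β₁ (Nat.cast_nonneg m)
        _ = 20 / √(p : ℝ) * (1 / √|β₂|) := by ring
        _ ≤ 20 / √(p : ℝ) * (√q * √p) := by gcongr
        _ = _ := by field_simp
    have hX : √(p : ℝ) * (m * √|β₂|) ≤ 8 * √q := by
      have h1 : √(p : ℝ) * √|β₂| * √q ≤ 8 := by
        rw [← Real.sqrt_mul hp0.le, ← Real.sqrt_mul (by positivity),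
          Real.sqrt_le_left (by norm_num)]
        rw [le_div_iff₀ (by positivity)] at hub
        linarith
      calc √(p : ℝ) * (m * √|β₂|) ≤ √(p : ℝ) * ((√q * √q) * √|β₂|) := by
            rw [hss]
            gcongr
        _ = (√(p : ℝ) * √|β₂| * √q) * √q := by ring
        _ ≤ 8 * √q := by gcongr
    have htri := norm_le_norm_add_norm_sub' (∑ n ∈ range m, gaussPhase a b q n)
      ((p : ℂ)⁻¹ * (∑ r ∈ range p, gaussPhase c d p r) *
        ∫ u in (0 : ℝ)..m, e (β₁ * u + β₂ * u ^ 2))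
    have h3 : √(p : ℝ) * (1 + m * √|β₂|) ≤ 9 * √q := by
      rw [mul_add]
      linarith
    have h4 : C * (√(p : ℝ) * (1 + m * √|β₂|)) ≤ C * (9 * √q) := by gcongr
    have h5 : 3 * (32 + 16 * C) * √(p : ℝ) ≤ 3 * (32 + 16 * C) * (√q / 8) := by
      gcongr
      linarith
    have h6 : 0 < C * √q := by positivity
    linarith

theorem norm_sum_Icc_sub_sum_range_le (x t : ℝ) (N : ℕ) :
    ‖∑ n ∈ Icc 1 N, e (x * n + t * (n : ℝ) ^ 2) - ∑ n ∈ range N, e (x * n + t * (n : ℝ) ^ 2)‖ ≤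
      2 := by
  have h1 : ∑ n ∈ Icc 1 N, e (x * n + t * (n : ℝ) ^ 2) =
      ∑ n ∈ range N, e (x * (n + 1 : ℕ) + t * ((n + 1 : ℕ) : ℝ) ^ 2) := by
    rw [range_eq_Ico, sum_Ico_add' (fun n : ℕ => e (x * n + t * (n : ℝ) ^ 2)) 0 N 1]
    rfl
  rw [h1, ← sum_sub_distrib, sum_range_sub fun n : ℕ => e (x * n + t * (n : ℝ) ^ 2)]
  exact (norm_sub_le _ _).trans (by rw [norm_e, norm_e]; norm_num)

end WeylSum

open WeylSum in
/-- Vaughan's major-arc decomposition of the one-variable quadratic Weyl sum. -/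
theorem stmt15 :
    ∃ C > (0 : ℝ), ∀ (N q a b : ℕ) (x t : ℝ),
      1 ≤ a → a ≤ N → 1 ≤ q → q ≤ N → Nat.Coprime a q →
      |t - (a : ℝ) / q| ≤ (q : ℝ)⁻¹ * (N : ℝ)⁻¹ →
      1 ≤ b → b ≤ q → |x - (b : ℝ) / q| ≤ 1 / (2 * q) →
      ‖(∑ n ∈ Finset.Icc 1 N,
            Complex.exp (2 * Real.pi * Complex.I * ((x * n + t * (n : ℝ) ^ 2 : ℝ) : ℂ))) -
          (q : ℂ)⁻¹ *
            (∑ r ∈ Finset.range q,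
              Complex.exp (2 * Real.pi * Complex.I *
                (((b : ℝ) * r / q + (a : ℝ) * (r : ℝ) ^ 2 / q : ℝ) : ℂ))) *
            (∫ ξ in (0 : ℝ)..(N : ℝ),
              Complex.exp (2 * Real.pi * Complex.I *
                (((x - (b : ℝ) / q) * ξ + (t - (a : ℝ) / q) * ξ ^ 2 : ℝ) : ℂ)))‖ ≤
        C * ((q : ℝ) ^ (1 / 2 : ℝ) +
          (N : ℝ) * |t - (a : ℝ) / q| ^ (1 / 2 : ℝ) * (q : ℝ) ^ (1 / 2 : ℝ)) := by
  obtain ⟨C, hC, hmajor⟩ := exists_norm_sum_gaussPhase_mul_sub_le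
  obtain ⟨K, hK, hincomplete⟩ := exists_norm_sum_gaussPhase_le
  refine ⟨3 * K + C + 2, by positivity, ?_⟩
  intro N q a b x t ha haN hq _ hcop h₂ _ _ h₁
  have hq1 : (1 : ℝ) ≤ q := by exact_mod_cast hq
  have hq0 : (0 : ℝ) < q := by linarith
  have hN0 : (0 : ℝ) < N := by exact_mod_cast ha.trans haN
  set β₁ := x - (b : ℝ) / q with hβ₁
  set β₂ := t - (a : ℝ) / q with hβ₂
  have hcop' : IsCoprime (a : ℤ) q := Nat.isCoprime_iff_coprime.2 hcop
  have h₂' : N * |β₂| ≤ 64 / q := by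
    calc N * |β₂| ≤ N * ((q : ℝ)⁻¹ * (N : ℝ)⁻¹) := by gcongr
      _ = 1 / q := by field_simp
      _ ≤ 64 / q := by gcongr; norm_num
  have hmain := hmajor q N a b β₁ β₂ K hq hcop' h₁ h₂' (hincomplete q a b hq hcop')
  have hphase : ∀ n : ℕ, gaussPhase a b q n * e (β₁ * n + β₂ * (n : ℝ) ^ 2) =
      e (x * n + t * (n : ℝ) ^ 2) := fun n => by
    rw [gaussPhase, ← e_add]
    congr 1
    rw [hβ₁, hβ₂]
    push_cast
    field_simp
    ring
  have hgauss : ∀ r : ℕ, gaussPhase a b q r =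
      e ((b : ℝ) * r / q + (a : ℝ) * (r : ℝ) ^ 2 / q) := fun r => by
    rw [gaussPhase]
    congr 1
    push_cast
    ring
  simp only [hphase] at hmain
  simp only [hgauss] at hmain
  have htri := norm_add_le_of_le (norm_sum_Icc_sub_sum_range_le x t N) hmain
  rw [sub_add_sub_cancel] at htri
  refine htri.trans ?_
  rw [← Real.sqrt_eq_rpow, ← Real.sqrt_eq_rpow]
  have hs1 : 1 ≤ √(q : ℝ) := Real.one_le_sqrt.2 hq1
  have hX : 0 ≤ N * √|β₂| * √q := by positivity
  nlinarith [mul_nonneg hK.le hX]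
end
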